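/- Under the Setup, assume that 0 ≤ m ≤ M+1 and at least one of the following holds: (i) f^{(m+1)}/f^{(m)} is a real meromorphic function (i.e. maps ℝ into ℝ ∪ {∞}); (ii) F_m = G_m; (iii) g^{(m)} = c_m f^{(m)} for some complex constant c_m. Then f is a rational function with at least one non-real zero. -/

import Mathlib

open Complex Filter Topology MeasureTheory
open scoped Classical

noncomputable section

/-- `mtilde f` is the function `z ↦ conj (f (conj z))`, denoted `f̃` in the paper. -/
def mtilde (f : ℂ → ℂ) : ℂ → ℂ := fun z => (starRingEnd ℂ) (f ((starRingEnd ℂ) z))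

/-- Equality of meromorphic functions: near every point of `ℂ`, the two functions agree on a
punctured neighbourhood (so the set where they disagree is closed and discrete). -/
def MeroEq (h₁ h₂ : ℂ → ℂ) : Prop := ∀ z : ℂ, ∀ᶠ w in 𝓝[≠] z, h₁ w = h₂ w

/-- `f` is strictly non-real: `f̃` is not a constant multiple of `f`. -/
def StrictlyNonReal (f : ℂ → ℂ) : Prop := ¬ ∃ c : ℂ, MeroEq (mtilde f) (fun z => c * f z)

/-- A rational function, as a meromorphic function on `ℂ`. -/
def IsRatFn (h : ℂ → ℂ) : Prop :=
  ∃ p q : Polynomial ℂ, q ≠ 0 ∧ MeroEq h (fun z => p.eval z / q.eval z)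

/-- The order of vanishing (negative at a pole) of a function at a point, when the function is
meromorphic there; junk value `0` otherwise. -/
def meroOrder (h : ℂ → ℂ) (z : ℂ) : WithTop ℤ :=
  if hh : MeromorphicAt h z then meromorphicOrderAt h z else 0

/-- The positive part of the logarithm. -/
def logPlus (x : ℝ) : ℝ := max (Real.log x) 0

/-- The Nevanlinna proximity function `m(r, h)`. -/
def proximity (h : ℂ → ℂ) (r : ℝ) : ℝ :=
  (2 * Real.pi)⁻¹ * ∫ θ in (0:ℝ)..(2 * Real.pi),
    logPlus ‖h ((r : ℂ) * Complex.exp (θ * Complex.I))‖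

/-- The multiplicity of a pole of `h` at `z` (0 if not a pole). -/
def poleMult (h : ℂ → ℂ) (z : ℂ) : ℕ := (-((meroOrder h z).untopD 0)).toNat

/-- The number of poles, counted with multiplicity, in the closed disc of radius `t`. -/
def poleCount (h : ℂ → ℂ) (t : ℝ) : ℝ := ∑ᶠ z ∈ Metric.closedBall (0:ℂ) t, (poleMult h z : ℝ)

/-- The integrated counting function `N(r, h)` of the poles of `h` (with multiplicity). -/
def NCount (h : ℂ → ℂ) (r : ℝ) : ℝ := ∫ t in (1:ℝ)..r, poleCount h t / t

/-- The Nevanlinna characteristic `T(r, h) = m(r, h) + N(r, h)`. -/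
def TChar (h : ℂ → ℂ) (r : ℝ) : ℝ := proximity h r + NCount h r

/-- The number of points of `S` in the closed disc of radius `t`. -/
def distinctCount (S : Set ℂ) (t : ℝ) : ℝ := (S ∩ Metric.closedBall (0:ℂ) t).ncard

/-- The integrated counting function `N̄(r, h)` of the distinct poles of `h`. -/
def NbarPoles (h : ℂ → ℂ) (r : ℝ) : ℝ :=
  ∫ t in (1:ℝ)..r, distinctCount {z | meroOrder h z < 0} t / t

/-- The integrated counting function `N̄(r, 1/h)` of the distinct zeros of `h`. -/
def NbarZeros (h : ℂ → ℂ) (r : ℝ) : ℝ :=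
  ∫ t in (1:ℝ)..r, distinctCount {z | 0 < meroOrder h z} t / t

/-- `h` has finite (Nevanlinna) order: `T(r, h) ≤ r ^ C` for all large `r`. -/
def FiniteOrder (h : ℂ → ℂ) : Prop := ∃ C : ℝ, ∀ᶠ r in atTop, TChar h r ≤ r ^ C

/-- `h` has finite lower order: `T(r, h) ≤ r ^ C` for arbitrarily large `r`. -/
def FiniteLowerOrder (h : ℂ → ℂ) : Prop := ∃ C : ℝ, ∃ᶠ r in atTop, TChar h r ≤ r ^ C

/-- The Setup of Section 3 of the paper: `M ≥ 4` and `f` is a strictly non-real meromorphic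
function in the plane such that `f, f', …, f^(M+3)` all have finitely many non-real zeros. -/
def Setup (M : ℕ) (f : ℂ → ℂ) : Prop :=
  4 ≤ M ∧ (∀ z, MeromorphicAt f z) ∧ StrictlyNonReal f ∧
    ∀ m, m ≤ M + 3 → {z : ℂ | 0 < meroOrder (iteratedDeriv m f) z ∧ z.im ≠ 0}.Finite

/-- The function `F_m(z) = z - f^(m)(z) / f^(m+1)(z)`. -/
def Fm (f : ℂ → ℂ) (m : ℕ) : ℂ → ℂ :=
  fun z => z - iteratedDeriv m f z / iteratedDeriv (m + 1) f z

/-- `Km` is the meromorphic function with finitely many zeros and poles satisfying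
`F_m' = K_m G_m'`, where `G_m` is the analogue of `F_m` for `g = f̃`. -/
def IsKm (f : ℂ → ℂ) (m : ℕ) (Km : ℂ → ℂ) : Prop :=
  (∀ z, MeromorphicAt Km z) ∧ {z | 0 < meroOrder Km z}.Finite ∧
    {z | meroOrder Km z < 0}.Finite ∧
    MeroEq (deriv (Fm f m)) (fun z => Km z * deriv (Fm (mtilde f) m) z)

end

lemma pos_norm_id (a b : ℂ) :
    ‖a - b‖ ^ 2 = ‖a + (starRingEnd ℂ) b‖ ^ 2 - 4 * a.re * b.re := by
  rw [← Complex.normSq_eq_norm_sq, ← Complex.normSq_eq_norm_sq, Complex.normSq_apply,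
    Complex.normSq_apply]
  simp
  ring

lemma pos_schwarz {f : ℂ → ℂ} {c : ℂ} {R : ℝ} (hR : 0 < R)
    (hf : DifferentiableOn ℂ f (Metric.ball c R)) (hpos : ∀ z ∈ Metric.ball c R, 0 < (f z).re) :
    ‖deriv f c‖ ≤ 2 * (f c).re / R ∧
    ∀ z ∈ Metric.ball c R, (f c).re * (1 - dist z c / R) / 4 ≤ (f z).re := by
  have hc : c ∈ Metric.ball c R := Metric.mem_ball_self hR
  have h0 : 0 < (f c).re := hpos c hc
  set g : ℂ → ℂ := fun z => (f z - f c) / (f z + (starRingEnd ℂ) (f c)) with hg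
  have hden : ∀ z ∈ Metric.ball c R, f z + (starRingEnd ℂ) (f c) ≠ 0 := by
    intro z hz h
    have := congrArg Complex.re h
    simp at this
    linarith [hpos z hz]
  have hgd : DifferentiableOn ℂ g (Metric.ball c R) := by
    intro z hz
    exact ((hf z hz).sub_const _).div ((hf z hz).add_const _) (hden z hz)
  have hgc : g c = 0 := by simp [hg]
  have hmaps : Set.MapsTo g (Metric.ball c R) (Metric.closedBall (g c) 1) := by
    intro z hz
    rw [hgc, mem_closedBall_zero_iff, hg]
    simp only [norm_div]
    rw [div_le_one (norm_pos_iff.2 (hden z hz))]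
    have := pos_norm_id (f z) (f c)
    have h1 := hpos z hz
    refine abs_le_of_sq_le_sq' ?_ (norm_nonneg _) |>.2
    nlinarith [mul_pos h1 h0]
  constructor
  · have h1 := Complex.norm_deriv_le_div_of_mapsTo_ball hgd hmaps hR
    have hfd : HasDerivAt f (deriv f c) c :=
      (hf.differentiableAt (Metric.ball_mem_nhds c hR)).hasDerivAt
    have h2 := (hfd.sub_const (f c)).div (hfd.add_const ((starRingEnd ℂ) (f c))) (hden c hc)
    have h3 : deriv g c = deriv f c / (2 * (f c).re : ℝ) := by
      have := h2.deriv
      have e : f c + (starRingEnd ℂ) (f c) = ((2 * (f c).re : ℝ) : ℂ) := by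
        rw [Complex.add_conj]
      rw [e] at this
      have hne : ((2 * (f c).re : ℝ) : ℂ) ≠ 0 := by
        exact_mod_cast (by positivity)
      rw [show g = ((fun x => f x - f c) / fun x => f x + (starRingEnd ℂ) (f c)) from rfl, this]
      field_simp
      ring
    rw [h3, norm_div, Complex.norm_real, Real.norm_of_nonneg (by positivity)] at h1
    rw [div_le_div_iff₀ (by positivity) hR] at h1
    rw [le_div_iff₀ hR]
    linarith
  · intro z hz
    have h1 := Complex.dist_le_div_mul_dist_of_mapsTo_ball hgd hmaps hz
    rw [hgc, dist_zero_right, hg] at h1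
    simp only [norm_div] at h1
    rw [div_le_iff₀ (norm_pos_iff.2 (hden z hz))] at h1
    set s := 1 / R * dist z c with hs
    have hs0 : 0 ≤ s := by positivity
    have hs1 : s < 1 := by
      rw [hs, one_div, inv_mul_lt_iff₀ hR]; simpa using hz
    have e : dist z c / R = s := by rw [hs]; ring
    rw [e]
    have h2 := pos_norm_id (f z) (f c)
    have h3 : ‖f z - f c‖ ^ 2 ≤ s ^ 2 * ‖f z + (starRingEnd ℂ) (f c)‖ ^ 2 := by
      rw [← mul_pow]; gcongr
    have h4 : (f c).re ≤ ‖f z + (starRingEnd ℂ) (f c)‖ := by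
      refine le_trans ?_ (Complex.re_le_norm _)
      simp [(hpos z hz).le]
    have h5 : (f c).re ^ 2 ≤ ‖f z + (starRingEnd ℂ) (f c)‖ ^ 2 := by gcongr
    have h6 : (1 - s ^ 2) * (f c).re ^ 2 ≤ 4 * (f z).re * (f c).re := by
      have : 0 ≤ 1 - s ^ 2 := by nlinarith
      nlinarith [mul_le_mul_of_nonneg_left h5 this]
    have h7 : (1 - s ^ 2) * (f c).re ≤ 4 * (f z).re := by
      refine le_of_mul_le_mul_right ?_ h0
      linarith
    nlinarith [mul_nonneg hs0 h0.le, mul_nonneg (mul_nonneg hs0 h0.le) (sub_nonneg.2 hs1.le)]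

/-- Gronwall along a segment. -/
lemma gronwall_re {L : ℂ → ℂ} {s : Set ℂ} {c : ℝ} (hc : 0 < c) (hs : Convex ℝ s)
    (hL : ∀ z ∈ s, DifferentiableAt ℂ L z)
    (hb : ∀ z ∈ s, ‖deriv L z‖ ≤ c * (1 + |(L z).re|)) {w z : ℂ} (hw : w ∈ s) (hz : z ∈ s) :
    1 + |(L z).re| ≤ (1 + |(L w).re|) * Real.exp (c * ‖z - w‖) := by
  by_cases hzw : z = w
  · subst hzw; simp
  have hn : 0 < ‖z - w‖ := norm_pos_iff.2 (sub_ne_zero.2 hzw)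
  set γ : ℝ → ℂ := fun t => w + (t : ℂ) * (z - w) with hγ
  have hγs : ∀ t ∈ Set.Icc (0:ℝ) 1, γ t ∈ s := by
    intro t ht
    have := hs.add_smul_sub_mem hw hz ht
    simpa [hγ] using this
  have hγd : ∀ t : ℝ, HasDerivAt γ (z - w) t := by
    intro t
    have := ((Complex.ofRealCLM.hasDerivAt (x := t)).mul_const (z - w)).const_add w
    simpa [hγ] using this
  have hd : ∀ t ∈ Set.Icc (0:ℝ) 1,
      HasDerivAt (fun t : ℝ => (L (γ t)).re) ((deriv L (γ t) * (z - w)).re) t := by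
    intro t ht
    have h1 := (hL _ (hγs t ht)).hasDerivAt.comp_of_eq t (hγd t) rfl
    have h2 := (Complex.reCLM.hasFDerivAt (x := L (γ t))).comp_hasDerivAt t h1
    simpa [Function.comp_def] using h2
  have := norm_le_gronwallBound_of_norm_deriv_right_le (f := fun t : ℝ => (L (γ t)).re)
    (f' := fun t => (deriv L (γ t) * (z - w)).re) (δ := |(L w).re|) (K := c * ‖z - w‖)
    (ε := c * ‖z - w‖) (a := 0) (b := 1)
    (fun t ht => (hd t ht).continuousAt.continuousWithinAt)
    (fun t ht => (hd t ⟨ht.1, ht.2.le⟩).hasDerivWithinAt)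
    (by simp [hγ]) (by
      intro t ht
      have h1 := hb _ (hγs t ⟨ht.1, ht.2.le⟩)
      calc ‖(deriv L (γ t) * (z - w)).re‖ ≤ ‖deriv L (γ t) * (z - w)‖ := Complex.abs_re_le_norm _
        _ = ‖deriv L (γ t)‖ * ‖z - w‖ := norm_mul _ _
        _ ≤ (c * (1 + |(L (γ t)).re|)) * ‖z - w‖ := by gcongr
        _ = _ := by rw [Real.norm_eq_abs]; ring) 1 (by simp)
  rw [gronwallBound_of_K_ne_0 (by positivity)] at this
  simp only [hγ, Real.norm_eq_abs, sub_zero, mul_one] at this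
  rw [div_self (by positivity)] at this
  simp at this
  linarith

/-- A continuous nonvanishing real part on a ball has constant sign. -/
lemma sign_const {L : ℂ → ℂ} {c : ℂ} {R : ℝ} (hL : DifferentiableOn ℂ L (Metric.ball c R))
    (hne : ∀ z ∈ Metric.ball c R, (L z).re ≠ 0) :
    (∀ z ∈ Metric.ball c R, 0 < (L z).re) ∨ (∀ z ∈ Metric.ball c R, 0 < (-L z).re) := by
  have hcont : ContinuousOn (fun z => (L z).re) (Metric.ball c R) :=
    Complex.continuous_re.comp_continuousOn hL.continuousOn
  have hp : IsPreconnected (Metric.ball c R) := (convex_ball c R).isPreconnected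
  by_contra hcon
  push Not at hcon
  obtain ⟨⟨a, ha, ha'⟩, ⟨b, hb, hb'⟩⟩ := hcon
  simp at hb'
  have := hp.intermediate_value ha hb hcont
  obtain ⟨x, hx, hx'⟩ := this ⟨ha', hb'⟩
  exact hne x hx hx'

lemma ne_schwarz {f : ℂ → ℂ} {c : ℂ} {R : ℝ} (hR : 0 < R)
    (hf : DifferentiableOn ℂ f (Metric.ball c R)) (hne : ∀ z ∈ Metric.ball c R, (f z).re ≠ 0) :
    ‖deriv f c‖ ≤ 2 * |(f c).re| / R ∧
    ∀ z ∈ Metric.ball c R, |(f c).re| * (1 - dist z c / R) / 4 ≤ |(f z).re| := by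
  have hc : c ∈ Metric.ball c R := Metric.mem_ball_self hR
  rcases sign_const hf hne with h | h
  · obtain ⟨h1, h2⟩ := pos_schwarz hR hf h
    refine ⟨by rwa [abs_of_pos (h c hc)], fun z hz => ?_⟩
    rw [abs_of_pos (h c hc), abs_of_pos (h z hz)]
    exact h2 z hz
  · obtain ⟨h1, h2⟩ := pos_schwarz hR hf.neg h
    have e : ∀ z, (-f) z = - f z := fun z => rfl
    have hd : deriv (-f) c = - deriv f c := deriv.neg
    rw [hd, norm_neg] at h1
    simp only [e, Complex.neg_re] at h1 h2 h
    refine ⟨by rwa [← abs_neg, abs_of_pos (h c hc)], fun z hz => ?_⟩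
    rw [← abs_neg, abs_of_pos (h c hc), ← abs_neg (f z).re, abs_of_pos (h z hz)]
    exact h2 z hz

lemma growthA : ∃ C K0 : ℝ, 1 ≤ C ∧ 0 < K0 ∧ ∀ K, K0 ≤ K → ∀ L : ℂ → ℂ,
    DifferentiableOn ℂ L (Metric.ball 0 (K * (1 + |(L 0).re|))) → deriv L 0 = 1 →
    (∀ z ∈ Metric.ball (0:ℂ) (K * (1 + |(L 0).re|)),
      ‖deriv L z‖ * (1 + |(L 0).re|) ≤ 2 * (1 + |(L z).re|)) →
    |(L 0).re| ≤ C ∧ ∀ z ∈ Metric.ball (0:ℂ) (K / 8), ‖deriv L z‖ ≤ C := by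
  set E := Real.exp 6 with hE
  set e2 := Real.exp 2 with he2
  have hE1 : 1 ≤ E := Real.one_le_exp (by norm_num)
  have he21 : 1 ≤ e2 := Real.one_le_exp (by norm_num)
  refine ⟨E + 64 * e2 + 16, 24 * E, by linarith, by linarith, ?_⟩
  intro K hK L hL hL0 hb
  have hK24 : 24 ≤ K := by linarith
  set u0 := |(L 0).re| with hu0
  have hu0n : 0 ≤ u0 := abs_nonneg _
  have hB : K ≤ K * (1 + u0) := by nlinarith
  -- step 1 : a zero of the real part
  obtain ⟨z1, hz1, hz1'⟩ : ∃ z ∈ Metric.ball (0:ℂ) (3 * (1 + u0)), (L z).re = 0 := by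
    by_contra hcon
    push Not at hcon
    have hsub : Metric.ball (0:ℂ) (3 * (1 + u0)) ⊆ Metric.ball 0 (K * (1 + u0)) :=
      Metric.ball_subset_ball (by nlinarith)
    have h1 := (ne_schwarz (by positivity) (hL.mono hsub) hcon).1
    rw [hL0, norm_one, le_div_iff₀ (by positivity)] at h1
    linarith
  have hdiff : ∀ z ∈ Metric.ball (0:ℂ) (K * (1 + u0)), DifferentiableAt ℂ L z := fun z hz =>
    hL.differentiableAt (Metric.isOpen_ball.mem_nhds hz)
  have hz1B : z1 ∈ Metric.ball (0:ℂ) (K * (1 + u0)) :=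
    Metric.ball_subset_ball (by nlinarith) hz1
  have h0B : (0:ℂ) ∈ Metric.ball (0:ℂ) (K * (1 + u0)) := Metric.mem_ball_self (by positivity)
  have hu0E : 1 + u0 ≤ E := by
    have := gronwall_re (L := L) (c := 2 / (1 + u0)) (by positivity) (convex_ball 0 (K * (1 + u0)))
      hdiff (fun z hz => by
        rw [div_mul_eq_mul_div, le_div_iff₀ (by positivity)]; exact hb z hz) hz1B h0B
    rw [hz1', abs_zero, add_zero, one_mul] at this
    refine this.trans (Real.exp_le_exp.2 ?_)
    rw [zero_sub, norm_neg, div_mul_eq_mul_div, div_le_iff₀ (by positivity)]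
    have : ‖z1‖ < 3 * (1 + u0) := by simpa using hz1
    linarith
  refine ⟨by linarith, ?_⟩
  have hz1n : ‖z1‖ < K / 8 := by
    have : ‖z1‖ < 3 * (1 + u0) := by simpa using hz1
    linarith
  have hdiffK : ∀ z ∈ Metric.ball (0:ℂ) K, DifferentiableAt ℂ L z := fun z hz =>
    hdiff z (Metric.ball_subset_ball hB hz)
  have hbK : ∀ z ∈ Metric.ball (0:ℂ) K, ‖deriv L z‖ ≤ 2 * (1 + |(L z).re|) := fun z hz =>
    le_trans (le_mul_of_one_le_right (norm_nonneg _) (by linarith))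
      (hb z (Metric.ball_subset_ball hB hz))
  have hgr : ∀ w ∈ Metric.ball (0:ℂ) K, ∀ z ∈ Metric.ball (0:ℂ) K,
      1 + |(L z).re| ≤ (1 + |(L w).re|) * Real.exp (2 * ‖z - w‖) := fun w hw z hz =>
    gronwall_re (L := L) (c := 2) (by norm_num) (convex_ball 0 K) hdiffK hbK hw hz
  have hcont : ContinuousOn (fun z => (L z).re) (Metric.closedBall (0:ℂ) (3 * K / 4)) := by
    intro z hz
    have hz' : z ∈ Metric.ball (0:ℂ) K :=
      Metric.closedBall_subset_ball (by linarith) hz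
    exact (Complex.continuous_re.continuousAt.comp (hdiffK z hz').continuousAt).continuousWithinAt
  have hgrow : ∀ ζ ∈ Metric.ball (0:ℂ) (K / 4), |(L ζ).re| ≤ 2 * e2 * K := by
    intro ζ hζ
    have hζn : ‖ζ‖ < K / 4 := by simpa using hζ
    set Z := Metric.closedBall (0:ℂ) (3 * K / 4) ∩ (fun z => (L z).re) ⁻¹' {0} with hZ
    have hZc : IsCompact Z :=
      (isCompact_closedBall (0:ℂ) (3 * K / 4)).of_isClosed_subset
        (hcont.preimage_isClosed_of_isClosed Metric.isClosed_closedBall isClosed_singleton)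
        Set.inter_subset_left
    have hz1Z : z1 ∈ Z := ⟨by simp; linarith, hz1'⟩
    obtain ⟨q, hqZ, hq⟩ := hZc.exists_infDist_eq_dist ⟨z1, hz1Z⟩ ζ
    set t := dist ζ q with ht
    have htmin : ∀ z ∈ Z, t ≤ dist ζ z := fun z hz => hq ▸ Metric.infDist_le_dist_of_mem hz
    have ht0 : 0 ≤ t := dist_nonneg
    have htK : t ≤ 3 * K / 8 := by
      refine (htmin z1 hz1Z).trans ?_
      rw [dist_eq_norm]
      linarith [norm_sub_le ζ z1]
    have hqK : q ∈ Metric.ball (0:ℂ) K := Metric.closedBall_subset_ball (by linarith) hqZ.1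
    have hq0 : (L q).re = 0 := hqZ.2
    have hζK : ζ ∈ Metric.ball (0:ℂ) K := Metric.ball_subset_ball (by linarith) hζ
    rcases le_or_gt t 1 with h1 | h1
    · have := hgr q hqK ζ hζK
      rw [hq0, abs_zero, add_zero, one_mul, ← dist_eq_norm, ← ht] at this
      have h2 : Real.exp (2 * t) ≤ e2 := Real.exp_le_exp.2 (by linarith)
      nlinarith
    · have hballK : Metric.ball ζ t ⊆ Metric.ball (0:ℂ) (5 * K / 8) := by
        refine Metric.ball_subset_ball' ?_
        rw [dist_zero_right]; linarith
      have hsub : Metric.ball ζ t ⊆ Metric.ball (0:ℂ) K :=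
        hballK.trans (Metric.ball_subset_ball (by linarith))
      have hLd : DifferentiableOn ℂ L (Metric.ball ζ t) := fun z hz =>
        (hdiffK z (hsub hz)).differentiableWithinAt
      have hne : ∀ z ∈ Metric.ball ζ t, (L z).re ≠ 0 := by
        intro z hz h0
        have : z ∈ Z := ⟨(Metric.ball_subset_closedBall.trans
          (Metric.closedBall_subset_closedBall (by linarith))) (hballK hz), h0⟩
        have := htmin z this
        rw [Metric.mem_ball, dist_comm] at hz
        linarith
      have hS := (ne_schwarz (by linarith) hLd hne).2
      set p : ℂ := q + ((1 / t : ℝ) : ℂ) * (ζ - q) with hp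
      have htn : ‖ζ - q‖ = t := by rw [ht, dist_eq_norm]
      have hpq : ‖p - q‖ = 1 := by
        rw [hp, add_sub_cancel_left, norm_mul, htn, Complex.norm_real,
          Real.norm_of_nonneg (by positivity)]
        field_simp
      have hpζ : dist p ζ = t - 1 := by
        rw [dist_eq_norm, show p - ζ = ((1 / t - 1 : ℝ) : ℂ) * (ζ - q) by rw [hp]; push_cast; ring,
          norm_mul, htn, Complex.norm_real, Real.norm_eq_abs, abs_of_nonpos]
        · field_simp
          ring
        · rw [sub_nonpos, div_le_one (by linarith)]; exact h1.le
      have hpb : p ∈ Metric.ball ζ t := by rw [Metric.mem_ball, hpζ]; linarith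
      have h3 := hS p hpb
      rw [hpζ] at h3
      have h4 := hgr q hqK p (hsub hpb)
      rw [hq0, abs_zero, add_zero, one_mul, hpq, mul_one] at h4
      have h5 : |(L ζ).re| * (1 - (t - 1) / t) / 4 = |(L ζ).re| / (4 * t) := by
        field_simp
        ring
      rw [h5, div_le_iff₀ (by positivity)] at h3
      have h6 : |(L p).re| ≤ e2 := by linarith
      calc |(L ζ).re| ≤ |(L p).re| * (4 * t) := h3
        _ ≤ e2 * (4 * (3 * K / 8)) := by gcongr
        _ ≤ 2 * e2 * K := by nlinarith
  intro ζ hζ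
  have hζn : ‖ζ‖ < K / 8 := by simpa using hζ
  have hsub : Metric.ball ζ (K / 8) ⊆ Metric.ball (0:ℂ) (K / 4) := by
    refine Metric.ball_subset_ball' ?_
    rw [dist_zero_right]; linarith
  set M : ℝ := 2 * e2 * K + 1 with hM
  have h1 := (pos_schwarz (f := fun z => (M : ℂ) - L z) (c := ζ) (R := K / 8) (by linarith)
    (fun z hz => ((hdiffK z (Metric.ball_subset_ball (by linarith)
      (hsub hz))).const_sub _).differentiableWithinAt)
    (fun z hz => by
      have := (abs_le.1 (hgrow z (hsub hz))).2
      simp; linarith)).1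
  rw [deriv_const_sub, norm_neg] at h1
  refine h1.trans ?_
  rw [div_le_iff₀ (by linarith)]
  have := (abs_le.1 (hgrow ζ (Metric.ball_subset_ball (by linarith) hζ))).1
  simp
  nlinarith

/-- The numerator of the third derivative of `1 / (exp L - 1)`, up to a factor. -/
def PsiNum (x1 x2 x3 E : ℂ) : ℂ :=
  6 * x1 ^ 3 * E ^ 2 - 6 * x1 * (x2 + x1 ^ 2) * E * (E - 1)
    + (x3 + 3 * x1 * x2 + x1 ^ 3) * (E - 1) ^ 2

noncomputable def pFun (w : ℂ) : ℂ := Complex.exp w ^ 2 + 4 * Complex.exp w + 1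

lemma psi_lin (E : ℂ) : PsiNum 1 0 0 E = E ^ 2 + 4 * E + 1 := by
  unfold PsiNum; ring

noncomputable def ell : ℝ := Real.log (2 - Real.sqrt 3)

noncomputable def w0 : ℂ := (ell : ℂ) + Real.pi * Complex.I

lemma sqrt3_bounds : 1.73 < Real.sqrt 3 ∧ Real.sqrt 3 < 1.74 := by
  constructor
  · exact Real.lt_sqrt_of_sq_lt (by norm_num)
  · rw [Real.sqrt_lt' (by norm_num)]; norm_num

lemma exp_ell : Real.exp ell = 2 - Real.sqrt 3 :=
  Real.exp_log (by linarith [sqrt3_bounds.2])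

lemma ell_lt : ell < -1.1 := by
  unfold ell
  rw [Real.log_lt_iff_lt_exp (by linarith [sqrt3_bounds.2])]
  have h1 : (0.367:ℝ) < Real.exp (-1) := by
    have := Real.exp_neg_one_gt_d9; linarith
  have h2 : (0.9:ℝ) ≤ Real.exp (-0.1) := by
    have := Real.add_one_le_exp (-0.1:ℝ); linarith
  have h3 : Real.exp (-1.1) = Real.exp (-1) * Real.exp (-0.1) := by
    rw [← Real.exp_add]; norm_num
  rw [h3]
  nlinarith [sqrt3_bounds.1]

lemma exp_w0 : Complex.exp w0 = ((Real.sqrt 3 - 2 : ℝ) : ℂ) := by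
  unfold w0
  rw [Complex.exp_add, Complex.exp_pi_mul_I, ← Complex.ofReal_exp, exp_ell]
  push_cast; ring

lemma p_w0 : pFun w0 = 0 := by
  unfold pFun
  rw [exp_w0]
  have h : Real.sqrt 3 ^ 2 = 3 := Real.sq_sqrt (by norm_num)
  have : (Real.sqrt 3 - 2) ^ 2 + 4 * (Real.sqrt 3 - 2) + 1 = 0 := by nlinarith
  exact_mod_cast this

lemma p_sphere_ne (w : ℂ) (hw : w ∈ Metric.sphere w0 1) : pFun w ≠ 0 := by
  intro h
  have hd : ‖w - w0‖ = 1 := by simpa [dist_eq_norm] using hw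
  have hs : ((Real.sqrt 3 : ℝ) : ℂ) ^ 2 = 3 := by
    exact_mod_cast Real.sq_sqrt (by norm_num : (0:ℝ) ≤ 3)
  have hfac : (Complex.exp w - ((Real.sqrt 3 - 2 : ℝ) : ℂ)) *
      (Complex.exp w + ((Real.sqrt 3 + 2 : ℝ) : ℂ)) = 0 := by
    unfold pFun at h
    push_cast
    linear_combination h - hs
  rcases mul_eq_zero.1 hfac with h1 | h1
  · rw [sub_eq_zero, ← exp_w0, Complex.exp_eq_exp_iff_exists_int] at h1
    obtain ⟨n, hn⟩ := h1
    have h2 : w - w0 = n * (2 * Real.pi * Complex.I) := by rw [hn]; ring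
    rw [h2] at hd
    simp only [norm_mul, Complex.norm_intCast, Complex.norm_I, Complex.norm_real, mul_one,
      Complex.norm_ofNat, Real.norm_of_nonneg Real.pi_pos.le] at hd
    by_cases hn0 : n = 0
    · subst hn0; simp at hd
    · have : (1:ℝ) ≤ |(n:ℝ)| := by exact_mod_cast Int.one_le_abs hn0
      nlinarith [Real.pi_gt_three]
  · have h2 : Complex.exp w = - ((Real.sqrt 3 + 2 : ℝ) : ℂ) := eq_neg_of_add_eq_zero_left h1
    have h3 := congrArg norm h2
    rw [norm_neg, Complex.norm_real, Complex.norm_exp, Real.norm_of_nonneg (by positivity)] at h3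
    have h4 : w.re < 0 := by
      have := (abs_le.1 ((Complex.abs_re_le_norm (w - w0)).trans hd.le)).2
      simp [w0] at this
      linarith [ell_lt]
    have h5 : Real.exp w.re < 1 := by rw [← Real.exp_zero]; exact Real.exp_lt_exp.2 h4
    linarith [sqrt3_bounds.1]

lemma p_delta : ∃ δ : ℝ, 0 < δ ∧ ∀ w ∈ Metric.sphere w0 1, δ ≤ ‖pFun w‖ := by
  have hc : Continuous fun w => ‖pFun w‖ := by unfold pFun; fun_prop
  obtain ⟨x, hx, hmin⟩ := (isCompact_sphere w0 1).exists_isMinOn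
    (NormedSpace.sphere_nonempty.2 zero_le_one) hc.continuousOn
  exact ⟨‖pFun x‖, norm_pos_iff.2 (p_sphere_ne x hx), fun w hw => hmin hw⟩

lemma psi_unif (δ : ℝ) (hδ : 0 < δ) : ∃ η : ℝ, 0 < η ∧ ∀ e0 e1 x2 x3 : ℂ, ‖e0‖ < η → ‖e1‖ < η →
    ‖x2‖ < η → ‖x3‖ < η → ∀ w ∈ Metric.closedBall w0 1,
      ‖PsiNum (1 + e1) x2 x3 (Complex.exp (w + e0)) - pFun w‖ < δ := by
  have hcont : Continuous fun q : ℂ × (ℂ × ℂ × ℂ × ℂ) =>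
      ‖PsiNum (1 + q.2.2.1) q.2.2.2.1 q.2.2.2.2 (Complex.exp (q.1 + q.2.1)) - pFun q.1‖ := by
    unfold PsiNum pFun; fun_prop
  have := (isCompact_closedBall w0 1).eventually_forall_of_forall_eventually
    (x₀ := ((0, 0, 0, 0) : ℂ × ℂ × ℂ × ℂ))
    (P := fun y w => ‖PsiNum (1 + y.2.1) y.2.2.1 y.2.2.2 (Complex.exp (w + y.1)) - pFun w‖ < δ)
    (by
      intro w hw
      have h1 := hcont.comp (continuous_swap : Continuous (Prod.swap : (ℂ × ℂ × ℂ × ℂ) × ℂ → _))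
      refine (h1.tendsto ((0, 0, 0, 0), w)).eventually_lt_const ?_
      simp [psi_lin, pFun, hδ])
  obtain ⟨η, hη, h⟩ := Metric.eventually_nhds_iff.1 this
  refine ⟨η, hη, fun e0 e1 x2 x3 h0 h1 h2 h3 w hw => h (y := (e0, e1, x2, x3)) ?_ w hw⟩
  simp [Prod.dist_eq, h0, h1, h2, h3]

lemma lemmaA2 (C : ℝ) (hC : 1 ≤ C) : ∃ R : ℝ, 0 < R ∧ ∀ L : ℂ → ℂ,
    DifferentiableOn ℂ L (Metric.ball 0 R) → |(L 0).re| ≤ C → deriv L 0 = 1 →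
    (∀ z ∈ Metric.ball (0:ℂ) R, ‖deriv L z‖ ≤ C) →
    ∃ ζ ∈ Metric.ball (0:ℂ) R, (L ζ).re < 0 ∧
      PsiNum (deriv L ζ) (deriv (deriv L) ζ) (deriv (deriv (deriv L)) ζ) (Complex.exp (L ζ)) = 0 := by
  obtain ⟨δ, hδ, hsph⟩ := p_delta
  obtain ⟨η', hη', hpsi⟩ := psi_unif (δ / 4) (by linarith)
  set η := min η' 0.1 with hη
  have hη0 : 0 < η := lt_min hη' (by norm_num)
  set A : ℝ := |ell| + C + 6 with hA
  have hA1 : 1 ≤ A := by have := abs_nonneg ell; linarith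
  set ρ : ℝ := 4 + 4 * C * A ^ 2 / η with hρ
  have hρ4 : 4 ≤ ρ := by rw [hρ]; have : 0 ≤ 4 * C * A ^ 2 / η := by positivity
                         linarith
  set ε : ℝ := 2 * C / ρ with hε
  have hε0 : 0 < ε := by positivity
  have hεA : ε * A ^ 2 < η := by
    rw [hε, div_mul_eq_mul_div, div_lt_iff₀ (by linarith), hρ]
    have : η * (4 + 4 * C * A ^ 2 / η) = 4 * η + 4 * C * A ^ 2 := by field_simp
    rw [this]
    have : 0 < C * A ^ 2 := by positivity
    linarith
  have hεA1 : ε * A < η :=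
    lt_of_le_of_lt (mul_le_mul_of_nonneg_left (by nlinarith : A ≤ A ^ 2) hε0.le) hεA
  have hεη : ε < η := lt_of_le_of_lt (le_mul_of_one_le_right hε0.le hA1) hεA1
  refine ⟨A + ρ, by linarith, ?_⟩
  intro L hL hu hL0 hb
  set R := A + ρ with hR
  have hLd1 : DifferentiableOn ℂ (deriv L) (Metric.ball 0 R) := hL.deriv Metric.isOpen_ball
  have hLd2 : DifferentiableOn ℂ (deriv (deriv L)) (Metric.ball 0 R) :=
    hLd1.deriv Metric.isOpen_ball
  have hLd3 : DifferentiableOn ℂ (deriv (deriv (deriv L))) (Metric.ball 0 R) :=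
    hLd2.deriv Metric.isOpen_ball
  have hAR : Metric.ball (0:ℂ) A ⊆ Metric.ball 0 R := Metric.ball_subset_ball (by linarith)
  have hda : ∀ {h : ℂ → ℂ}, DifferentiableOn ℂ h (Metric.ball 0 R) →
      ∀ z ∈ Metric.ball (0:ℂ) A, DifferentiableAt ℂ h z := fun hh z hz =>
    hh.differentiableAt (Metric.isOpen_ball.mem_nhds (hAR hz))
  -- Cauchy estimates
  have hcl : ∀ z ∈ Metric.ball (0:ℂ) A, Metric.closedBall z (ρ / 2) ⊆ Metric.ball 0 R := by
    intro z hz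
    refine Metric.closedBall_subset_ball' ?_
    have : dist z 0 < A := hz
    linarith
  have hdc : ∀ z ∈ Metric.ball (0:ℂ) A, DiffContOnCl ℂ (deriv L) (Metric.ball z (ρ / 2)) := by
    intro z hz
    exact (hLd1.mono (hcl z hz)).diffContOnCl_ball (Set.Subset.refl _)
  have hsp : ∀ z ∈ Metric.ball (0:ℂ) A, ∀ x ∈ Metric.sphere z (ρ / 2), ‖deriv L x‖ ≤ C :=
    fun z hz x hx => hb x (hcl z hz (Metric.sphere_subset_closedBall hx))
  have h2 : ∀ z ∈ Metric.ball (0:ℂ) A, ‖deriv (deriv L) z‖ ≤ ε := by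
    intro z hz
    have := Complex.norm_deriv_le_of_forall_mem_sphere_norm_le (by linarith) (hdc z hz) (hsp z hz)
    refine this.trans (le_of_eq ?_)
    rw [hε]; field_simp
  have h3 : ∀ z ∈ Metric.ball (0:ℂ) A, ‖deriv (deriv (deriv L)) z‖ ≤ ε := by
    intro z hz
    have := Complex.norm_iteratedDeriv_le_of_forall_mem_sphere_norm_le 2 (by linarith)
      (hdc z hz) (hsp z hz)
    rw [iteratedDeriv_succ, iteratedDeriv_one] at this
    refine this.trans ?_
    rw [hε, div_le_div_iff₀ (by positivity) (by positivity)]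
    simp [Nat.factorial]
    have : 0 < C * ρ := by positivity
    nlinarith
  have h0A : (0:ℂ) ∈ Metric.ball (0:ℂ) A := Metric.mem_ball_self (by linarith)
  have h1 : ∀ z ∈ Metric.ball (0:ℂ) A, ‖deriv L z - 1‖ ≤ ε * A := by
    intro z hz
    have := (convex_ball (0:ℂ) A).norm_image_sub_le_of_norm_deriv_le
      (fun x hx => hda hLd1 x hx) h2 h0A hz
    rw [hL0] at this
    refine this.trans ?_
    gcongr
    have : dist z 0 < A := hz
    rw [← dist_eq_norm]; exact this.le
  have h0 : ∀ z ∈ Metric.ball (0:ℂ) A, ‖L z - (L 0 + z)‖ ≤ ε * A ^ 2 := by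
    intro z hz
    have hdd : ∀ x ∈ Metric.ball (0:ℂ) A, HasDerivAt (fun x => L x - x) (deriv L x - 1) x :=
      fun x hx => (hda hL x hx).hasDerivAt.sub (hasDerivAt_id x)
    have := (convex_ball (0:ℂ) A).norm_image_sub_le_of_norm_deriv_le (f := fun x => L x - x)
      (C := ε * A) (fun x hx => (hdd x hx).differentiableAt)
      (fun x hx => by rw [(hdd x hx).deriv]; exact h1 x hx) h0A hz
    rw [show L z - (L 0 + z) = L z - z - (L 0 - 0) by ring, pow_two, ← mul_assoc]
    refine this.trans ?_
    gcongr
    have : dist z 0 < A := hz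
    rw [← dist_eq_norm]; exact this.le
  -- the centre
  obtain ⟨k, hk⟩ : ∃ k : ℤ, |Real.pi - (L 0).im + k * (2 * Real.pi)| ≤ 4 := by
    set x := Real.pi - (L 0).im
    refine ⟨-round (x / (2 * Real.pi)), ?_⟩
    have := abs_sub_round (x / (2 * Real.pi))
    have hpi := Real.pi_pos
    have e : x + ((-round (x / (2 * Real.pi)) : ℤ) : ℝ) * (2 * Real.pi)
        = (x / (2 * Real.pi) - round (x / (2 * Real.pi))) * (2 * Real.pi) := by
      push_cast; field_simp; ring
    rw [e, abs_mul, abs_of_pos (by positivity : 0 < 2 * Real.pi)]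
    nlinarith [Real.pi_lt_four]
  set ζ0 : ℂ := w0 - L 0 + k * (2 * Real.pi * Complex.I) with hζ0
  have hζ0n : ‖ζ0‖ ≤ |ell| + C + 4 := by
    refine (Complex.norm_le_abs_re_add_abs_im ζ0).trans ?_
    have hre : ζ0.re = ell - (L 0).re := by simp [hζ0, w0]
    have him : ζ0.im = Real.pi - (L 0).im + k * (2 * Real.pi) := by simp [hζ0, w0]
    rw [hre, him]
    have := abs_sub ell (L 0).re
    linarith
  have hball : Metric.closedBall ζ0 1 ⊆ Metric.ball (0:ℂ) A := by
    refine Metric.closedBall_subset_ball' ?_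
    rw [dist_zero_right]; linarith
  set τ : ℂ → ℂ := fun ζ => PsiNum (deriv L ζ) (deriv (deriv L) ζ) (deriv (deriv (deriv L)) ζ)
    (Complex.exp (L ζ)) with hτ
  have hτclose : ∀ ζ ∈ Metric.closedBall ζ0 1, ‖τ ζ - pFun (w0 + (ζ - ζ0))‖ < δ / 4 := by
    intro ζ hζ
    have hζA := hball hζ
    have hm := min_le_left η' 0.1
    have := hpsi (L ζ - (L 0 + ζ)) (deriv L ζ - 1) (deriv (deriv L) ζ)
      (deriv (deriv (deriv L)) ζ) (by linarith [h0 ζ hζA]) (by linarith [h1 ζ hζA])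
      (by linarith [h2 ζ hζA]) (by linarith [h3 ζ hζA]) (w0 + (ζ - ζ0)) (by
        rw [Metric.mem_closedBall, dist_eq_norm] at hζ ⊢
        simpa using hζ)
    have e : Complex.exp (w0 + (ζ - ζ0) + (L ζ - (L 0 + ζ))) = Complex.exp (L ζ) := by
      rw [Complex.exp_eq_exp_iff_exists_int]
      refine ⟨-k, ?_⟩
      rw [hζ0]; push_cast; ring
    rw [e, add_sub_cancel] at this
    exact this
  have hre : ∀ ζ ∈ Metric.closedBall ζ0 1, (L ζ).re < 0 := by
    intro ζ hζ
    have hm := min_le_right η' 0.1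
    have ha := (abs_le.1 ((Complex.abs_re_le_norm _).trans (h0 ζ (hball hζ)))).2
    rw [Metric.mem_closedBall, dist_eq_norm] at hζ
    have hb := (abs_le.1 ((Complex.abs_re_le_norm _).trans hζ)).2
    have hre : ζ0.re = ell - (L 0).re := by simp [hζ0, w0]
    simp only [Complex.sub_re, Complex.add_re] at ha hb
    linarith [ell_lt]
  by_contra hcon
  push Not at hcon
  have hτne : ∀ ζ ∈ Metric.closedBall ζ0 1, τ ζ ≠ 0 := fun ζ hζ =>
    hcon ζ (hAR (hball hζ)) (hre ζ hζ)
  have hτd : DifferentiableOn ℂ (fun ζ => (τ ζ)⁻¹) (Metric.closedBall ζ0 1) := by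
    intro ζ hζ
    have hζA := hball hζ
    have d0 := hda hL ζ hζA
    have d1 := hda hLd1 ζ hζA
    have d2 := hda hLd2 ζ hζA
    have d3 := hda hLd3 ζ hζA
    refine (DifferentiableAt.inv ?_ (hτne ζ hζ)).differentiableWithinAt
    simp only [hτ, PsiNum]
    fun_prop
  have hmax := Complex.norm_le_of_forall_mem_frontier_norm_le (U := Metric.ball ζ0 1)
    Metric.isBounded_ball (hτd.diffContOnCl_ball (Set.Subset.refl _)) (C := (3 * δ / 4)⁻¹)
    (by
      intro z hz
      rw [frontier_ball ζ0 one_ne_zero] at hz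
      have hz' := Metric.sphere_subset_closedBall hz
      rw [norm_inv]
      have hc := hτclose z hz'
      have hp := hsph (w0 + (z - ζ0)) (by
        rw [mem_sphere_iff_norm] at hz ⊢; simpa using hz)
      refine inv_anti₀ (by linarith) ?_
      have := norm_sub_norm_le (pFun (w0 + (z - ζ0))) (τ z)
      rw [norm_sub_rev] at this
      linarith) (z := ζ0) (subset_closure (Metric.mem_ball_self one_pos))
  have hself : ζ0 ∈ Metric.closedBall ζ0 1 := Metric.mem_closedBall_self zero_le_one
  have hc := hτclose ζ0 hself
  rw [sub_self, add_zero, p_w0, sub_zero] at hc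
  rw [norm_inv, inv_le_inv₀ (norm_pos_iff.2 (hτne ζ0 hself)) (by linarith)] at hmax
  linarith

lemma lemmaA : ∃ K : ℝ, 0 < K ∧ ∀ L : ℂ → ℂ,
    DifferentiableOn ℂ L (Metric.ball 0 (K * (1 + |(L 0).re|))) → deriv L 0 = 1 →
    (∀ z ∈ Metric.ball (0:ℂ) (K * (1 + |(L 0).re|)),
      ‖deriv L z‖ * (1 + |(L 0).re|) ≤ 2 * (1 + |(L z).re|)) →
    ∃ ζ ∈ Metric.ball (0:ℂ) (K * (1 + |(L 0).re|)), (L ζ).re < 0 ∧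
      PsiNum (deriv L ζ) (deriv (deriv L) ζ) (deriv (deriv (deriv L)) ζ) (Complex.exp (L ζ)) = 0 := by
  obtain ⟨C, K0, hC, hK0, hA⟩ := growthA
  obtain ⟨R, hR, hA2⟩ := lemmaA2 C hC
  refine ⟨max K0 (8 * R), lt_max_of_lt_left hK0, ?_⟩
  intro L hL hL0 hb
  set K := max K0 (8 * R) with hK
  have hK8 : R ≤ K / 8 := by have := le_max_right K0 (8 * R); linarith
  have hKp : 0 < K := lt_max_of_lt_left hK0
  have hsub : Metric.ball (0:ℂ) R ⊆ Metric.ball 0 (K * (1 + |(L 0).re|)) := by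
    refine Metric.ball_subset_ball ?_
    have := mul_nonneg hKp.le (abs_nonneg (L 0).re)
    linarith
  obtain ⟨h1, h2⟩ := hA K (le_max_left _ _) L hL hL0 hb
  obtain ⟨ζ, hζ, hζ'⟩ := hA2 L (hL.mono hsub) h1 hL0
    (fun z hz => h2 z (Metric.ball_subset_ball hK8 hz))
  exact ⟨ζ, hsub hζ, hζ'⟩

noncomputable def NumW (W : ℂ → ℂ) (z : ℂ) : ℂ :=
  6 * deriv W z ^ 3 - 6 * deriv W z * deriv (deriv W) z * (W z - 1)
    + deriv (deriv (deriv W)) z * (W z - 1) ^ 2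

lemma numW_exp {W L : ℂ → ℂ} {s : Set ℂ} (hs : IsOpen s) (hL : DifferentiableOn ℂ L s)
    (hexp : ∀ z ∈ s, W z = Complex.exp (L z)) {z : ℂ} (hz : z ∈ s) :
    deriv W z = deriv L z * W z ∧
    NumW W z = W z * PsiNum (deriv L z) (deriv (deriv L) z) (deriv (deriv (deriv L)) z)
      (Complex.exp (L z)) := by
  have hL1 : DifferentiableOn ℂ (deriv L) s := hL.deriv hs
  have hL2 : DifferentiableOn ℂ (deriv (deriv L)) s := hL1.deriv hs
  have da : ∀ {h : ℂ → ℂ}, DifferentiableOn ℂ h s → ∀ z ∈ s, HasDerivAt h (deriv h z) z :=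
    fun h z hz => (h.differentiableAt (hs.mem_nhds hz)).hasDerivAt
  have hev : ∀ {h k : ℂ → ℂ} , (∀ z ∈ s, h z = k z) → ∀ z ∈ s, h =ᶠ[𝓝 z] k := by
    intro h k hk z hz
    filter_upwards [hs.mem_nhds hz] with w hw using hk w hw
  have d1 : ∀ z ∈ s, deriv W z = deriv L z * Complex.exp (L z) := by
    intro z hz
    rw [(hev hexp z hz).deriv_eq, (da hL z hz).cexp.deriv]; ring
  have d2 : ∀ z ∈ s, deriv (deriv W) z
      = (deriv (deriv L) z + deriv L z ^ 2) * Complex.exp (L z) := by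
    intro z hz
    have h : HasDerivAt (fun z => deriv L z * Complex.exp (L z)) _ z :=
      (da hL1 z hz).mul (da hL z hz).cexp
    rw [(hev d1 z hz).deriv_eq, h.deriv]; ring
  have d3 : ∀ z ∈ s, deriv (deriv (deriv W)) z
      = (deriv (deriv (deriv L)) z + 3 * deriv L z * deriv (deriv L) z + deriv L z ^ 3)
        * Complex.exp (L z) := by
    intro z hz
    have h : HasDerivAt (fun z => (deriv (deriv L) z + deriv L z ^ 2) * Complex.exp (L z)) _ z :=
      ((da hL2 z hz).add ((da hL1 z hz).pow 2)).mul (da hL z hz).cexp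
    rw [(hev d2 z hz).deriv_eq, h.deriv]
    simp; ring
  refine ⟨by rw [d1 z hz, hexp z hz], ?_⟩
  unfold NumW PsiNum
  rw [d1 z hz, d2 z hz, d3 z hz, hexp z hz]
  ring

lemma exists_log_ball {W : ℂ → ℂ} {c : ℂ} {r : ℝ} (hr : 0 < r)
    (hW : ∀ z ∈ Metric.ball c r, AnalyticAt ℂ W z ∧ W z ≠ 0) :
    ∃ L : ℂ → ℂ, DifferentiableOn ℂ L (Metric.ball c r) ∧
      ∀ z ∈ Metric.ball c r, W z = Complex.exp (L z) := by
  have hd : DifferentiableOn ℂ (fun z => deriv W z / W z) (Metric.ball c r) := fun z hz =>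
    ((hW z hz).1.deriv.differentiableAt.div (hW z hz).1.differentiableAt
      (hW z hz).2).differentiableWithinAt
  obtain ⟨L, hLc, hL⟩ := (hd.isExactOn_ball).with_val_at c (Complex.log (W c))
  have hc : c ∈ Metric.ball c r := Metric.mem_ball_self hr
  refine ⟨L, fun z hz => (hL z hz).differentiableAt.differentiableWithinAt, ?_⟩
  have hconst : ∀ z ∈ Metric.ball c r, W z * Complex.exp (-L z) = W c * Complex.exp (-L c) := by
    intro z hz
    have hder : ∀ z ∈ Metric.ball c r,
        HasDerivAt (fun z => W z * Complex.exp (-L z)) 0 z := by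
      intro z hz
      have h1 : HasDerivAt (fun z => W z * Complex.exp (-L z)) _ z :=
        (hW z hz).1.differentiableAt.hasDerivAt.mul ((hL z hz).neg.cexp)
      have h2 : deriv W z * Complex.exp (-L z)
          + W z * (Complex.exp (-L z) * -(deriv W z / W z)) = 0 := by
        have := (hW z hz).2
        field_simp
        ring
      exact h2 ▸ h1
    exact (convex_ball c r).is_const_of_fderivWithin_eq_zero (𝕜 := ℂ)
      (fun z hz => (hder z hz).differentiableAt.differentiableWithinAt)
      (fun z hz => by
        rw [fderivWithin_of_isOpen Metric.isOpen_ball hz]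
        have := (hder z hz).hasFDerivAt.fderiv
        rw [this]; ext; simp) hz hc
  intro z hz
  have h1 := hconst z hz
  rw [hLc, Complex.exp_neg, Complex.exp_neg, Complex.exp_log (hW c hc).2,
    mul_inv_cancel₀ (hW c hc).2] at h1
  have := Complex.exp_ne_zero (L z)
  field_simp at h1
  exact h1

lemma lemB : ∃ K : ℝ, 0 < K ∧ ∀ (W : ℂ → ℂ) (R0 : ℝ),
    (∀ z, R0 < ‖z‖ → AnalyticAt ℂ W z ∧ W z ≠ 0) →
    (∀ z, R0 < ‖z‖ → ‖W z‖ < 1 → NumW W z ≠ 0) →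
    ∀ R1, R0 < R1 → ∀ z, R1 < ‖z‖ →
      ‖deriv W z / W z‖ * (‖z‖ - R1) ≤ 2 * K * (1 + |Real.log ‖W z‖|) := by
  obtain ⟨K, hK, hA⟩ := lemmaA
  refine ⟨K, hK, ?_⟩
  intro W R0 hW hN R1 hR1 z0 hz0
  by_contra hcon
  push Not at hcon
  set ν : ℂ → ℝ := fun z => ‖deriv W z / W z‖ / (1 + |Real.log ‖W z‖|) with hν
  have hpos : ∀ z, 0 < 1 + |Real.log ‖W z‖| := fun z => by positivity
  set ρ := ‖z0‖ - R1 with hρ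
  have hρ0 : 0 < ρ := by linarith
  have hν0 : 2 * K < ν z0 * ρ := by
    simp only [hν]; rw [div_mul_eq_mul_div, lt_div_iff₀ (hpos z0)]; exact hcon
  have hin : ∀ z ∈ Metric.closedBall z0 ρ, R0 < ‖z‖ := by
    intro z hz
    rw [Metric.mem_closedBall, dist_eq_norm] at hz
    have := norm_sub_norm_le z0 z
    rw [norm_sub_rev] at this
    linarith
  have hνc : ∀ z, R0 < ‖z‖ → ContinuousAt ν z := by
    intro z hz
    have h1 := (hW z hz).1.continuousAt
    have h2 := (hW z hz).1.deriv.continuousAt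
    have h3 := (hW z hz).2
    refine ((h2.div h1 h3).norm).div ?_ (hpos z).ne'
    exact continuousAt_const.add ((h1.norm.log (norm_ne_zero_iff.2 h3)).abs)
  have hcont : ContinuousOn (fun z => ν z * (ρ - ‖z - z0‖)) (Metric.closedBall z0 ρ) := by
    intro z hz
    refine ((hνc z (hin z hz)).mul ?_).continuousWithinAt
    fun_prop
  obtain ⟨zs, hzs, hmax⟩ := (isCompact_closedBall z0 ρ).exists_isMaxOn
    ⟨z0, Metric.mem_closedBall_self hρ0.le⟩ hcont
  set δ := ρ - ‖zs - z0‖ with hδ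
  have h1 : 2 * K < ν zs * δ := by
    have := hmax (Metric.mem_closedBall_self hρ0.le)
    simp at this
    exact hν0.trans_le this
  have hνnn : ∀ z, 0 ≤ ν z := fun z => div_nonneg (norm_nonneg _) (hpos z).le
  have hδ0 : 0 < δ := by
    by_contra h
    push Not at h
    nlinarith [hνnn zs, mul_nonneg (hνnn zs) (neg_nonneg.2 h)]
  have hνs : 0 < ν zs := by
    rcases (hνnn zs).lt_or_eq with h | h
    · exact h
    · rw [← h] at h1; linarith
  set r := K / ν zs with hr
  have hr0 : 0 < r := div_pos hK hνs
  have hrδ : r < δ / 2 := by rw [hr, div_lt_iff₀ hνs]; linarith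
  have hsub : ∀ z ∈ Metric.ball zs r, z ∈ Metric.closedBall z0 ρ ∧ ν z ≤ 2 * ν zs := by
    intro z hz
    rw [Metric.mem_ball, dist_eq_norm] at hz
    have h2 : ‖z - z0‖ ≤ ‖z - zs‖ + ‖zs - z0‖ := norm_sub_le_norm_sub_add_norm_sub z zs z0
    have hzc : z ∈ Metric.closedBall z0 ρ := by
      rw [Metric.mem_closedBall, dist_eq_norm]; linarith
    refine ⟨hzc, ?_⟩
    have h3 := hmax hzc
    simp only [Set.mem_ofPred_eq] at h3
    have h4 : δ / 2 ≤ ρ - ‖z - z0‖ := by linarith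
    have h5 : ν z * (δ / 2) ≤ ν zs * δ := (mul_le_mul_of_nonneg_left h4 (hνnn z)).trans h3
    have h6 : ν z * δ ≤ 2 * ν zs * δ := by linarith
    exact le_of_mul_le_mul_right h6 hδ0
  obtain ⟨L, hLd, hLexp⟩ := exists_log_ball (W := W) (c := zs) hr0
    (fun z hz => hW z (hin z (hsub z hz).1))
  have hnum := fun z (hz : z ∈ Metric.ball zs r) =>
    numW_exp Metric.isOpen_ball hLd hLexp hz
  have hlog : ∀ z ∈ Metric.ball zs r, Real.log ‖W z‖ = (L z).re := by
    intro z hz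
    rw [hLexp z hz, Complex.norm_exp, Real.log_exp]
  have hld : ∀ z ∈ Metric.ball zs r, deriv W z / W z = deriv L z := by
    intro z hz
    rw [(hnum z hz).1, mul_div_cancel_right₀ _ (hW z (hin z (hsub z hz).1)).2]
  have hzsb : zs ∈ Metric.ball zs r := Metric.mem_ball_self hr0
  set a := deriv L zs with ha
  have hνa : ν zs * (1 + |(L zs).re|) = ‖a‖ := by
    simp only [hν]
    rw [hlog zs hzsb, hld zs hzsb, div_mul_cancel₀]
    positivity
  have ha0 : a ≠ 0 := by
    rw [← norm_pos_iff, ← hνa]; positivity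
  have hrad : K * (1 + |(L zs).re|) = r * ‖a‖ := by
    rw [hr, ← hνa]; field_simp
  set L1 : ℂ → ℂ := fun ζ => L (zs + a⁻¹ * ζ) with hL1
  have hmap : ∀ ζ ∈ Metric.ball (0:ℂ) (K * (1 + |(L zs).re|)), zs + a⁻¹ * ζ ∈ Metric.ball zs r := by
    intro ζ hζ
    rw [hrad, mem_ball_zero_iff] at hζ
    rw [Metric.mem_ball, dist_eq_norm, add_sub_cancel_left, norm_mul, norm_inv,
      inv_mul_lt_iff₀ (norm_pos_iff.2 ha0)]
    linarith
  have hgen : ∀ (h : ℂ → ℂ) (b : ℂ), deriv (fun ζ => b * h (zs + a⁻¹ * ζ))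
      = fun ζ => b * a⁻¹ * deriv h (zs + a⁻¹ * ζ) := by
    intro h b
    funext ζ
    rw [deriv_const_mul_field]
    have := deriv_comp_mul_left a⁻¹ (fun x => h (zs + x)) ζ
    rw [this, deriv_comp_const_add, smul_eq_mul]; ring
  have e1 : deriv L1 = fun ζ => a⁻¹ * deriv L (zs + a⁻¹ * ζ) := by
    have := hgen L 1
    simpa using this
  have e2 : deriv (deriv L1) = fun ζ => a⁻¹ * a⁻¹ * deriv (deriv L) (zs + a⁻¹ * ζ) := by
    rw [e1, hgen]
  have e3 : deriv (deriv (deriv L1))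
      = fun ζ => a⁻¹ * a⁻¹ * a⁻¹ * deriv (deriv (deriv L)) (zs + a⁻¹ * ζ) := by
    rw [e2, hgen]
  have hL10 : L1 0 = L zs := by simp [hL1]
  obtain ⟨ζ, hζ, hre, hpsi⟩ := hA L1
    (by
      rw [hL10]
      intro ζ hζ
      have := hLd.differentiableAt (Metric.isOpen_ball.mem_nhds (hmap ζ hζ))
      refine DifferentiableAt.differentiableWithinAt ?_
      exact DifferentiableAt.comp ζ (f := fun ζ => zs + a⁻¹ * ζ) (g := L) this (by fun_prop))
    (by rw [e1]; simp [← ha, ha0])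
    (by
      rw [hL10]
      intro ζ hζ
      have hm := hmap ζ hζ
      have h2 := (hsub _ hm).2
      have h3 : ‖deriv L (zs + a⁻¹ * ζ)‖ ≤ 2 * ν zs * (1 + |(L (zs + a⁻¹ * ζ)).re|) := by
        simp only [hν] at h2 ⊢
        rw [hlog _ hm, hld _ hm, div_le_iff₀ (by positivity)] at h2
        exact h2
      rw [e1]
      simp only [norm_mul, norm_inv, hL1]
      have hna : 0 < ‖a‖ := norm_pos_iff.2 ha0
      rw [mul_assoc, inv_mul_le_iff₀ hna, ← hνa]
      calc _ ≤ (2 * ν zs * (1 + |(L (zs + a⁻¹ * ζ)).re|)) * (1 + |(L zs).re|) := by gcongr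
        _ = _ := by ring)
  rw [hL10] at hζ
  have hm := hmap ζ hζ
  have hzz := hin _ (hsub _ hm).1
  refine hN _ hzz ?_ ?_
  · rw [hLexp _ hm, Complex.norm_exp]
    rw [← Real.exp_zero]; exact Real.exp_lt_exp.2 hre
  · rw [(hnum _ hm).2]
    rw [e3, e2, e1] at hpsi
    have : PsiNum (a⁻¹ * deriv L (zs + a⁻¹ * ζ)) (a⁻¹ * a⁻¹ * deriv (deriv L) (zs + a⁻¹ * ζ))
        (a⁻¹ * a⁻¹ * a⁻¹ * deriv (deriv (deriv L)) (zs + a⁻¹ * ζ)) (Complex.exp (L1 ζ))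
        = a⁻¹ ^ 3 * PsiNum (deriv L (zs + a⁻¹ * ζ)) (deriv (deriv L) (zs + a⁻¹ * ζ))
        (deriv (deriv (deriv L)) (zs + a⁻¹ * ζ)) (Complex.exp (L (zs + a⁻¹ * ζ))) := by
      unfold PsiNum; simp only [hL1]; ring
    simp only [this] at hpsi
    rcases mul_eq_zero.1 hpsi with h | h
    · exact absurd h (pow_ne_zero _ (inv_ne_zero ha0))
    · rw [h, mul_zero]

lemma deriv_log_ray {W : ℂ → ℂ} {a : ℂ} {s : ℝ}
    (hW : AnalyticAt ℂ W ((Real.exp s : ℝ) * a)) (h0 : W ((Real.exp s : ℝ) * a) ≠ 0) :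
    ∃ v : ℝ, HasDerivAt (fun s : ℝ => Real.log ‖W ((Real.exp s : ℝ) * a)‖) v s ∧
      |v| ≤ ‖deriv W ((Real.exp s : ℝ) * a) / W ((Real.exp s : ℝ) * a)‖
        * ‖(Real.exp s : ℝ) * a‖ := by
  set γ : ℝ → ℂ := fun s => (Real.exp s : ℝ) * a with hγ
  have hev : ∀ᶠ z in 𝓝 (γ s), AnalyticAt ℂ W z ∧ W z ≠ 0 :=
    hW.eventually_analyticAt.and (hW.continuousAt.eventually_ne h0)
  obtain ⟨r, hr, hb⟩ := Metric.eventually_nhds_iff_ball.1 hev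
  obtain ⟨L, hLd, hLexp⟩ := exists_log_ball hr hb
  have hin : γ s ∈ Metric.ball (γ s) r := Metric.mem_ball_self hr
  have hγd : HasDerivAt γ (γ s) s := by
    have := (Real.hasDerivAt_exp s).ofReal_comp.mul_const a
    exact this
  have hLs : HasDerivAt L (deriv L (γ s)) (γ s) :=
    (hLd.differentiableAt (Metric.isOpen_ball.mem_nhds hin)).hasDerivAt
  have h1 : HasDerivAt (fun s => L (γ s)) (deriv L (γ s) * γ s) s := hLs.comp s hγd
  have h2 : HasDerivAt (fun s => (L (γ s)).re) (deriv L (γ s) * γ s).re s :=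
    (Complex.reCLM.hasFDerivAt.comp_hasDerivAt s h1)
  refine ⟨_, h2.congr_of_eventuallyEq ?_, ?_⟩
  · have := hγd.continuousAt.eventually (Metric.isOpen_ball.mem_nhds hin)
    filter_upwards [this] with t ht
    rw [hLexp _ ht, Complex.norm_exp, Real.log_exp]
  · refine (Complex.abs_re_le_norm _).trans ?_
    rw [norm_mul]
    have := (numW_exp Metric.isOpen_ball hLd hLexp hin).1
    change ‖deriv L (γ s)‖ * ‖γ s‖ ≤ ‖deriv W (γ s) / W (γ s)‖ * ‖γ s‖
    rw [this, mul_div_cancel_right₀ _ h0]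

lemma ray_setup {W : ℂ → ℂ} {R : ℝ} (hR : 0 < R)
    (hW : ∀ z, R ≤ ‖z‖ → AnalyticAt ℂ W z ∧ W z ≠ 0) :
    ∃ B : ℝ, 0 ≤ B ∧ ∀ a : ℂ, ‖a‖ = R → |Real.log ‖W a‖| ≤ B := by
  have hc : ContinuousOn (fun z => |Real.log ‖W z‖|) (Metric.sphere 0 R) := by
    intro z hz
    have hz' : R ≤ ‖z‖ := by simp at hz; exact hz.ge
    exact (((hW z hz').1.continuousAt.norm.log
      (norm_ne_zero_iff.2 (hW z hz').2)).abs).continuousWithinAt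
  obtain ⟨B, hB⟩ := (isCompact_sphere (0:ℂ) R).bddAbove_image hc
  refine ⟨max B 0, le_max_right _ _, fun a ha => le_max_of_le_left (hB ⟨a, by simpa using ha, rfl⟩)⟩

lemma ray_point {R : ℝ} (hR : 0 < R) {z : ℂ} (hz : R ≤ ‖z‖) :
    ∃ (a : ℂ) (s : ℝ), ‖a‖ = R ∧ 0 ≤ s ∧ z = (Real.exp s : ℝ) * a ∧ Real.exp s = ‖z‖ / R := by
  have hz0 : 0 < ‖z‖ := hR.trans_le hz
  have he : Real.exp (Real.log (‖z‖ / R)) = ‖z‖ / R := Real.exp_log (by positivity)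
  refine ⟨((R / ‖z‖ : ℝ) : ℂ) * z, Real.log (‖z‖ / R), ?_, ?_, ?_, he⟩
  · rw [norm_mul, Complex.norm_real, Real.norm_of_nonneg (by positivity)]
    field_simp
  · exact Real.log_nonneg (by rw [le_div_iff₀ hR]; linarith)
  · rw [he, ← mul_assoc, ← Complex.ofReal_mul]
    have : ‖z‖ / R * (R / ‖z‖) = 1 := by field_simp
    rw [this]; simp

lemma ray_norm {R : ℝ} {a : ℂ} (ha : ‖a‖ = R) (hR : 0 < R) {s : ℝ} (hs : 0 ≤ s) :
    R ≤ ‖((Real.exp s : ℝ) : ℂ) * a‖ := by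
  rw [norm_mul, Complex.norm_real, Real.norm_of_nonneg (Real.exp_pos s).le, ha]
  have := Real.one_le_exp hs
  nlinarith

lemma growth1 {W : ℂ → ℂ} {R c : ℝ} (hR : 0 < R) (hc : 0 < c)
    (hW : ∀ z, R ≤ ‖z‖ → AnalyticAt ℂ W z ∧ W z ≠ 0)
    (hb : ∀ z, R ≤ ‖z‖ → ‖deriv W z / W z‖ * ‖z‖ ≤ c * (1 + |Real.log ‖W z‖|)) :
    ∃ (C : ℝ) (k : ℕ), 0 ≤ C ∧ ∀ z, R ≤ ‖z‖ → |Real.log ‖W z‖| ≤ C * ‖z‖ ^ k := by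
  obtain ⟨B, hB0, hB⟩ := ray_setup hR hW
  obtain ⟨k, hk⟩ := exists_nat_ge c
  refine ⟨(B + 1) / R ^ k, k, by positivity, ?_⟩
  intro z hz
  obtain ⟨a, s, ha, hs, hza, hes⟩ := ray_point hR hz
  have hd : ∀ t : ℝ, 0 ≤ t → _ := fun t ht => deriv_log_ray (s := t) (a := a)
    (hW _ (ray_norm ha hR ht)).1 (hW _ (ray_norm ha hR ht)).2
  choose! v hv hvb using hd
  have := norm_le_gronwallBound_of_norm_deriv_right_le (E := ℝ) (δ := B) (K := c) (ε := c)
    (a := 0) (b := s) (f := fun s : ℝ => Real.log ‖W ((Real.exp s : ℝ) * a)‖) (f' := v)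
    (fun t ht => (hv t ht.1).continuousAt.continuousWithinAt)
    (fun t ht => (hv t ht.1).hasDerivWithinAt)
    (by simpa using hB a ha)
    (fun t ht => by
      have h1 := (hvb t ht.1).trans (hb _ (ray_norm ha hR ht.1))
      rw [Real.norm_eq_abs, Real.norm_eq_abs]; linarith)
    s ⟨hs, le_rfl⟩
  rw [Real.norm_eq_abs, ← hza, gronwallBound_of_K_ne_0 hc.ne', div_self hc.ne', sub_zero] at this
  have hek : Real.exp (c * s) ≤ (‖z‖ / R) ^ k := by
    rw [← hes, ← Real.exp_nat_mul]
    exact Real.exp_le_exp.2 (by gcongr)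
  calc |Real.log ‖W z‖| ≤ (B + 1) * Real.exp (c * s) := by linarith
    _ ≤ (B + 1) * (‖z‖ / R) ^ k := by gcongr
    _ = _ := by rw [div_pow]; ring

lemma growth2 {W : ℂ → ℂ} {R A : ℝ} (hR : 0 < R) (hA : 0 ≤ A)
    (hW : ∀ z, R ≤ ‖z‖ → AnalyticAt ℂ W z ∧ W z ≠ 0)
    (hb : ∀ z, R ≤ ‖z‖ → ‖deriv W z / W z‖ * ‖z‖ ≤ A) :
    ∃ (C : ℝ) (k : ℕ), 0 ≤ C ∧ ∀ z, R ≤ ‖z‖ → ‖W z‖ ≤ C * ‖z‖ ^ k := by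
  obtain ⟨B, hB0, hB⟩ := ray_setup hR hW
  obtain ⟨k, hk⟩ := exists_nat_ge A
  refine ⟨Real.exp B / R ^ k, k, by positivity, ?_⟩
  intro z hz
  obtain ⟨a, s, ha, hs, hza, hes⟩ := ray_point hR hz
  have hd : ∀ t : ℝ, 0 ≤ t → _ := fun t ht => deriv_log_ray (s := t) (a := a)
    (hW _ (ray_norm ha hR ht)).1 (hW _ (ray_norm ha hR ht)).2
  choose! v hv hvb using hd
  have := norm_image_sub_le_of_norm_deriv_le_segment' (E := ℝ)
    (a := 0) (b := s) (f := fun s : ℝ => Real.log ‖W ((Real.exp s : ℝ) * a)‖) (f' := v) (C := A)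
    (fun t ht => (hv t ht.1).hasDerivWithinAt)
    (fun t ht => (hvb t ht.1).trans (hb _ (ray_norm ha hR ht.1)))
    s ⟨hs, le_rfl⟩
  rw [← hza, Real.norm_eq_abs, sub_zero] at this
  simp only [Real.exp_zero, Complex.ofReal_one, one_mul] at this
  have h1 := abs_le.1 (hB a ha)
  have h2 := abs_le.1 this
  have h3 : Real.log ‖W z‖ ≤ B + k * s := by
    have : A * s ≤ k * s := by gcongr
    linarith [h1.2, h2.2]
  have hpos : 0 < ‖W z‖ := norm_pos_iff.2 (hW z hz).2
  rw [Real.log_le_iff_le_exp hpos, Real.exp_add, Real.exp_nat_mul, hes] at h3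
  refine h3.trans (le_of_eq ?_)
  rw [div_pow]; ring

lemma entire_poly {P : ℂ → ℂ} (hP : Differentiable ℂ P) {R C : ℝ} {k : ℕ}
    (hb : ∀ z, R ≤ ‖z‖ → ‖P z‖ ≤ C * ‖z‖ ^ k) :
    ∃ p : Polynomial ℂ, ∀ z, P z = p.eval z := by
  have hzero : ∀ n, k < n → iteratedDeriv n P 0 = 0 := by
    intro n hn
    by_contra h
    have hD : 0 < ‖iteratedDeriv n P 0‖ := norm_pos_iff.2 h
    set D := ‖iteratedDeriv n P 0‖ with hDdef
    have key : ∀ r : ℝ, R ≤ r → 1 ≤ r → D * r ≤ n.factorial * C := by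
      intro r hr h1
      have h0 : 0 < r := by linarith
      have := Complex.norm_iteratedDeriv_le_of_forall_mem_sphere_norm_le (c := 0) n h0
        hP.diffContOnCl (C := C * r ^ k) (fun z hz => by
          have hz' : ‖z‖ = r := by simpa using hz
          rw [← hz']; exact hb z (by rw [hz']; exact hr))
      rw [le_div_iff₀ (by positivity), ← hDdef] at this
      have hC : 0 ≤ n.factorial * C := by
        have h2 : 0 ≤ n.factorial * (C * r ^ k) := le_trans (by positivity) this
        have h3 : (n.factorial * C) * r ^ k ≥ 0 := by linarith
        exact nonneg_of_mul_nonneg_left h3 (by positivity)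
      obtain ⟨j, rfl⟩ := Nat.exists_eq_add_of_lt hn
      have h4 : D * r * r ^ j * r ^ k ≤ (k + j + 1).factorial * C * r ^ k := by
        calc _ = D * r ^ (k + j + 1) := by ring
          _ ≤ _ := this
          _ = _ := by ring
      have h5 := le_of_mul_le_mul_right h4 (by positivity)
      refine le_trans ?_ h5
      exact le_mul_of_one_le_right (by positivity) (one_le_pow₀ h1)
    have h1 := key (max (max R 1) ((n.factorial * C + 1) / D)) (by simp) (by simp)
    have h2 : (n.factorial * C + 1) ≤ D * max (max R 1) ((n.factorial * C + 1) / D) := by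
      calc _ = D * ((n.factorial * C + 1) / D) := by field_simp
        _ ≤ _ := by gcongr; exact le_max_right _ _
    linarith
  refine ⟨∑ n ∈ Finset.range (k + 1),
    Polynomial.C ((n.factorial : ℂ)⁻¹ * iteratedDeriv n P 0) * Polynomial.X ^ n, ?_⟩
  intro z
  have h1 := Complex.hasSum_taylorSeries_of_entire hP 0 z
  have h2 := hasSum_sum_of_ne_finset_zero (L := SummationFilter.unconditional ℕ) (s := Finset.range (k + 1))
    (f := fun n : ℕ => (n.factorial : ℂ)⁻¹ • (z - 0) ^ n • iteratedDeriv n P 0) (fun n hn => by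
      rw [hzero n (by simpa using hn)]; simp)
  rw [h1.unique h2, Polynomial.eval_finsetSum]
  refine Finset.sum_congr rfl fun n _ => ?_
  simp; ring

lemma MeroEq.symm' {a b : ℂ → ℂ} (h : MeroEq a b) : MeroEq b a := fun z =>
  (h z).mono fun _ hw => hw.symm

lemma MeroEq.trans' {a b c : ℂ → ℂ} (h : MeroEq a b) (h2 : MeroEq b c) : MeroEq a c := fun z => by
  filter_upwards [h z, h2 z] with w h1 h2 using h1.trans h2

lemma MeroEq.deriv' {a b : ℂ → ℂ} (h : MeroEq a b) : MeroEq (deriv a) (deriv b) := fun z =>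
  Filter.EventuallyEq.nhdsNE_deriv (h z)

lemma exists_nf {h : ℂ → ℂ} (hh : ∀ z, MeromorphicAt h z) :
    ∃ H : ℂ → ℂ, MeroEq h H ∧ ∀ z, MeromorphicNFAt H z := by
  have hm : MeromorphicOn h Set.univ := fun z _ => hh z
  refine ⟨toMeromorphicNFOn h Set.univ, fun z => ?_, fun z => ?_⟩
  · exact (hm.toMeromorphicNFOn_eq_self_on_nhdsNE (Set.mem_univ z)).symm
  · exact meromorphicNFOn_toMeromorphicNFOn h Set.univ (Set.mem_univ z)

lemma exists_entire {h : ℂ → ℂ} (hh : ∀ z, MeromorphicAt h z)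
    (ho : ∀ z, 0 ≤ meromorphicOrderAt h z) :
    ∃ H : ℂ → ℂ, MeroEq h H ∧ Differentiable ℂ H := by
  obtain ⟨H, hH, hnf⟩ := exists_nf hh
  refine ⟨H, hH, fun z => ?_⟩
  have h1 := ho z
  rw [meromorphicOrderAt_congr (hH z)] at h1
  exact ((hnf z).meromorphicOrderAt_nonneg_iff_analyticAt.1 h1).differentiableAt

lemma bound_order {h : ℂ → ℂ} {z : ℂ} {B : ℝ} 
    (hb : ∀ᶠ w in 𝓝[≠] z, ‖h w‖ ≤ B) : 0 ≤ meromorphicOrderAt h z := by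
  by_contra hlt
  push Not at hlt
  have h1 := tendsto_norm_cobounded_atTop.comp (tendsto_cobounded_of_meromorphicOrderAt_neg hlt)
  have h2 := h1.eventually (eventually_gt_atTop B)
  obtain ⟨w, hw1, hw2⟩ := (hb.and h2).exists
  exact absurd hw1 (not_le.2 hw2)

lemma poly_bound (q : Polynomial ℂ) : ∃ C : ℝ, 0 ≤ C ∧ ∀ z : ℂ, 1 ≤ ‖z‖ →
    ‖q.eval z‖ ≤ C * ‖z‖ ^ q.natDegree := by
  refine ⟨∑ i ∈ Finset.range (q.natDegree + 1), ‖q.coeff i‖, by positivity, fun z hz => ?_⟩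
  rw [Polynomial.eval_eq_sum_range, Finset.sum_mul]
  refine (norm_sum_le _ _).trans (Finset.sum_le_sum fun i hi => ?_)
  rw [norm_mul, norm_pow]
  gcongr
  simpa [Nat.lt_succ_iff] using hi

lemma rat_of_growth {h : ℂ → ℂ} (hh : ∀ z, MeromorphicAt h z) {R C : ℝ} {k : ℕ}
    (hb : ∀ z, R ≤ ‖z‖ → ‖h z‖ ≤ C * ‖z‖ ^ k) : IsRatFn h := by
  have hm : MeromorphicOn h (Metric.closedBall 0 R) := fun z _ => hh z
  have hfin := (MeromorphicOn.divisor h (Metric.closedBall 0 R)).finiteSupport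
    (isCompact_closedBall 0 R)
  set D := MeromorphicOn.divisor h (Metric.closedBall 0 R) with hD
  set S := hfin.toFinset with hS
  set q : Polynomial ℂ := ∏ a ∈ S, (Polynomial.X - Polynomial.C a) ^ (D a).natAbs with hq
  have hq0 : q ≠ 0 := Finset.prod_ne_zero_iff.2 fun a _ =>
    pow_ne_zero _ (Polynomial.X_sub_C_ne_zero a)
  have hqan : ∀ (q : Polynomial ℂ) z, AnalyticAt ℂ (fun z => q.eval z) z := fun q z =>
    (Polynomial.differentiable q).analyticAt z
  have hqm : ∀ z, MeromorphicAt (fun z => q.eval z * h z) z := fun z =>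
    (hqan q z).meromorphicAt.mul (hh z)
  have hord : ∀ z, 0 ≤ meromorphicOrderAt (fun z => q.eval z * h z) z := by
    intro z
    have e1 : meromorphicOrderAt (fun z => q.eval z * h z) z
        = meromorphicOrderAt (fun z => q.eval z) z + meromorphicOrderAt h z :=
      meromorphicOrderAt_mul (hqan q z).meromorphicAt (hh z)
    rw [e1]
    have hqn := (hqan q z).meromorphicOrderAt_nonneg
    by_cases hz : z ∈ Metric.closedBall (0:ℂ) R
    · have hDz : D z = (meromorphicOrderAt h z).untop₀ := MeromorphicOn.divisor_apply hm hz
      by_cases hzS : z ∈ S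
      · have hfac : (fun w => q.eval w) = fun w => (w - z) ^ (D z).natAbs *
            (∏ a ∈ S.erase z, (Polynomial.X - Polynomial.C a) ^ (D a).natAbs).eval w := by
          funext w
          rw [hq, ← Finset.mul_prod_erase S _ hzS]
          simp
        have e2 : meromorphicOrderAt (fun w => q.eval w) z = ((D z).natAbs : ℤ) +
            meromorphicOrderAt (fun w => (∏ a ∈ S.erase z,
              (Polynomial.X - Polynomial.C a) ^ (D a).natAbs).eval w) z := by
          rw [hfac]
          have e3 := meromorphicOrderAt_mul (x := z) (f := fun w => (w - z) ^ (D z).natAbs)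
            (g := fun w => (∏ a ∈ S.erase z,
              (Polynomial.X - Polynomial.C a) ^ (D a).natAbs).eval w)
            (by fun_prop) (hqan _ z).meromorphicAt
          have e4 : meromorphicOrderAt (fun w : ℂ => (w - z) ^ (D z).natAbs) z
            = ((D z).natAbs : ℤ) := by
            have := fun_meromorphicOrderAt_pow_id_sub_const (𝕜 := ℂ) (x := z) (n := (D z).natAbs)
            rw [this]; rfl
          rw [← e4]; exact e3
        have hn2 := (hqan (∏ a ∈ S.erase z,
              (Polynomial.X - Polynomial.C a) ^ (D a).natAbs) z).meromorphicOrderAt_nonneg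
        rw [e2, add_assoc, add_comm (meromorphicOrderAt _ z), ← add_assoc]
        refine add_nonneg ?_ hn2
        cases ho : meromorphicOrderAt h z with
        | top => simp
        | coe n =>
          rw [ho] at hDz
          simp at hDz
          rw [hDz]
          norm_cast
          linarith [neg_abs_le n]
      · have hz0 : D z = 0 := by simpa [hS] using hzS
        rw [hz0] at hDz
        refine add_nonneg hqn ?_
        rcases (WithTop.untop₀_eq_zero).1 hDz.symm with h | h <;> simp [h]
    · have hz' : R < ‖z‖ := by simpa using hz
      refine add_nonneg hqn (bound_order (B := |C| * (‖z‖ + 1) ^ k) ?_)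
      have h1 : ∀ᶠ w in 𝓝 z, R < ‖w‖ ∧ ‖w‖ < ‖z‖ + 1 :=
        (continuous_norm.continuousAt.eventually (lt_mem_nhds hz')).and
          (continuous_norm.continuousAt.eventually (gt_mem_nhds (by linarith)))
      filter_upwards [h1.filter_mono nhdsWithin_le_nhds] with w hw
      refine (hb w hw.1.le).trans ?_
      have : C ≤ |C| := le_abs_self C
      gcongr
      exact hw.2.le
  obtain ⟨P, hP, hPd⟩ := exists_entire hqm hord
  obtain ⟨C', hC', hqb⟩ := poly_bound q
  obtain ⟨p, hp⟩ := entire_poly hPd (R := max R 1 + 1) (C := C' * |C|) (k := q.natDegree + k) (by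
    intro z hz
    have h1 : Tendsto (fun w => ‖P w‖) (𝓝[≠] z) (𝓝 ‖P z‖) :=
      (hPd.continuous.norm.tendsto z).mono_left nhdsWithin_le_nhds
    have h2 : Tendsto (fun w : ℂ => C' * |C| * ‖w‖ ^ (q.natDegree + k)) (𝓝[≠] z)
        (𝓝 (C' * |C| * ‖z‖ ^ (q.natDegree + k))) :=
      (((continuous_const.mul (continuous_norm.pow _))).tendsto z).mono_left nhdsWithin_le_nhds
    refine le_of_tendsto_of_tendsto h1 h2 ?_
    have h3 : ∀ᶠ w in 𝓝 z, max R 1 < ‖w‖ :=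
      continuous_norm.continuousAt.eventually (lt_mem_nhds (by linarith))
    filter_upwards [h3.filter_mono nhdsWithin_le_nhds, hP z] with w hw hw2
    rw [← hw2, norm_mul]
    have hR' := (le_max_left R 1).trans hw.le
    have h1' := (le_max_right R 1).trans hw.le
    calc _ ≤ (C' * ‖w‖ ^ q.natDegree) * (|C| * ‖w‖ ^ k) := by
          gcongr
          · exact hqb w h1'
          · refine (hb w hR').trans ?_
            gcongr
            exact le_abs_self C
      _ = _ := by ring)
  refine ⟨p, q, hq0, fun z => ?_⟩
  have hne : ∀ᶠ w in 𝓝[≠] z, q.eval w ≠ 0 := by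
    have : ({w : ℂ | q.IsRoot w} \ {z}).Finite :=
      (Polynomial.finite_setOfPred_isRoot hq0).subset Set.sdiff_subset
    have h2 : ∀ᶠ w in 𝓝 z, w ∉ ({w : ℂ | q.IsRoot w} \ {z}) :=
      this.isClosed.isOpen_compl.mem_nhds (by simp)
    filter_upwards [h2.filter_mono nhdsWithin_le_nhds, self_mem_nhdsWithin] with w hw hwz h0
    exact hw ⟨h0, hwz⟩
  filter_upwards [hP z, hne] with w h1 h2
  rw [← hp w, ← h1]
  field_simp

lemma poly_ne_cobounded {q : Polynomial ℂ} (hq : q ≠ 0) :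
    ∀ᶠ z in Bornology.cobounded ℂ, q.eval z ≠ 0 := by
  have h := (Polynomial.finite_setOfPred_isRoot hq).isBounded
  exact Bornology.isBounded_def.1 h

lemma ofReal_tendsto_cobounded : Tendsto (fun x : ℝ => (x : ℂ)) atTop (Bornology.cobounded ℂ) := by
  rw [← tendsto_norm_atTop_iff_cobounded]
  simpa using tendsto_abs_atTop_atTop

lemma poly_compare {P Q : Polynomial ℂ} {B : ℝ}
    (h : ∀ᶠ x : ℝ in atTop, ‖P.eval (x : ℂ)‖ ≤ B * ‖Q.eval (x : ℂ)‖) :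
    ∃ A : ℝ, ∀ᶠ z in Bornology.cobounded ℂ, ‖P.eval z‖ ≤ A * ‖Q.eval z‖ := by
  by_cases hd : P.degree ≤ Q.degree
  · exact (Polynomial.isBigO_cobounded_of_degree_le hd).bound
  · push Not at hd
    exfalso
    have hP : P ≠ 0 := Polynomial.ne_zero_of_degree_gt hd
    have h1 := (Polynomial.isLittleO_cobounded_of_degree_lt hd).def
      (c := 1 / (2 * (|B| + 1))) (by positivity)
    have h2 := ofReal_tendsto_cobounded.eventually (h1.and (poly_ne_cobounded hP))
    obtain ⟨x, hx, hx1, hx2⟩ := (h.and h2).exists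
    have hpos : 0 < ‖P.eval (x:ℂ)‖ := norm_pos_iff.2 hx2
    have hB : B ≤ |B| + 1 := by linarith [le_abs_self B]
    have : B * ‖Q.eval (x:ℂ)‖ ≤ (|B| + 1) * (1 / (2 * (|B| + 1)) * ‖P.eval (x:ℂ)‖) := by gcongr
    have h3 : (|B| + 1) * (1 / (2 * (|B| + 1)) * ‖P.eval (x:ℂ)‖) = ‖P.eval (x:ℂ)‖ / 2 := by
      field_simp
    linarith

lemma W_rational {W : ℂ → ℂ} (hWm : ∀ z, MeromorphicAt W z) {R0 : ℝ}
    (hW : ∀ z, R0 < ‖z‖ → AnalyticAt ℂ W z ∧ W z ≠ 0)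
    (hN : ∀ z, R0 < ‖z‖ → ‖W z‖ < 1 → NumW W z ≠ 0)
    (hreal : ∀ x : ℝ, R0 < |x| → ‖W x‖ = 1) : IsRatFn W := by
  obtain ⟨K, hK, hB⟩ := lemB
  set R1 := max R0 0 + 1 with hR1
  have hR1a : 1 ≤ R1 := by linarith [le_max_right R0 0]
  have hR1b : R0 < R1 := by linarith [le_max_left R0 0]
  set R2 := 2 * R1 with hR2
  have hR2p : 0 < R2 := by linarith
  have hW2 : ∀ z, R2 ≤ ‖z‖ → AnalyticAt ℂ W z ∧ W z ≠ 0 := fun z hz => hW z (by linarith)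
  have hb : ∀ z, R2 ≤ ‖z‖ → ‖deriv W z / W z‖ * ‖z‖ ≤ 4 * K * (1 + |Real.log ‖W z‖|) := by
    intro z hz
    have h1 := hB W R0 hW hN R1 hR1b z (by linarith)
    have h2 : ‖deriv W z / W z‖ * (‖z‖ / 2) ≤ ‖deriv W z / W z‖ * (‖z‖ - R1) := by
      gcongr; linarith
    linarith
  obtain ⟨C, k, hC, hlog⟩ := growth1 hR2p (by positivity : 0 < 4 * K) hW2 hb
  set y : ℂ → ℂ := fun z => deriv W z / W z with hy
  have hym : ∀ z, MeromorphicAt y z := fun z => (hWm z).deriv.div (hWm z)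
  have hyb : ∀ z, R2 ≤ ‖z‖ → ‖y z‖ ≤ 4 * K * (1 + C) * ‖z‖ ^ k := by
    intro z hz
    have hz1 : 1 ≤ ‖z‖ := by linarith
    have h1 := hb z hz
    have h2 := hlog z hz
    have h3 : (1:ℝ) ≤ ‖z‖ ^ k := one_le_pow₀ hz1
    have h4 : 4 * K * (1 + |Real.log ‖W z‖|) ≤ 4 * K * (1 * ‖z‖ ^ k + C * ‖z‖ ^ k) := by
      gcongr; linarith
    have h5 : ‖y z‖ ≤ ‖y z‖ * ‖z‖ := le_mul_of_one_le_right (norm_nonneg _) hz1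
    calc ‖y z‖ ≤ _ := h5.trans (h1.trans h4)
      _ = _ := by ring
  obtain ⟨p, q, hq, hpq⟩ := rat_of_growth hym hyb
  -- exact equality for large z
  have hexact : ∀ z, R2 ≤ ‖z‖ → q.eval z ≠ 0 → y z = p.eval z / q.eval z := by
    intro z hz hqz
    have h1 : ContinuousAt y z :=
      (hW2 z hz).1.deriv.continuousAt.div (hW2 z hz).1.continuousAt (hW2 z hz).2
    have h2 : ContinuousAt (fun z => p.eval z / q.eval z) z :=
      p.continuous.continuousAt.div q.continuous.continuousAt hqz
    exact tendsto_nhds_unique_of_eventuallyEq (h1.tendsto.mono_left nhdsWithin_le_nhds)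
      (h2.tendsto.mono_left nhdsWithin_le_nhds) (hpq z)
  have hreal2 : ∀ᶠ x : ℝ in atTop,
      ‖(Polynomial.X * p).eval (x : ℂ)‖ ≤ 4 * K * ‖q.eval (x : ℂ)‖ := by
    filter_upwards [ofReal_tendsto_cobounded.eventually (poly_ne_cobounded hq),
      eventually_ge_atTop R2] with x hx1 hx2
    have habs : |x| = x := abs_of_nonneg (by linarith)
    have hxn : R2 ≤ ‖(x:ℂ)‖ := by rw [Complex.norm_real, Real.norm_eq_abs, habs]; exact hx2
    have h1 := hb x hxn
    rw [hreal x (by rw [habs]; linarith), Real.log_one, abs_zero, add_zero, mul_one] at h1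
    have h2 := hexact x hxn hx1
    simp only [hy] at h2
    rw [h2, norm_div, div_mul_eq_mul_div, div_le_iff₀ (norm_pos_iff.2 hx1)] at h1
    rw [Polynomial.eval_mul, Polynomial.eval_X, norm_mul]
    linarith
  obtain ⟨A, hA⟩ := poly_compare hreal2
  have hfin := hA.and (poly_ne_cobounded hq)
  rw [← comap_norm_atTop, eventually_comap] at hfin
  obtain ⟨R3, hR3⟩ := eventually_atTop.1 hfin
  set R4 := max R2 R3 with hR4
  have hR4p : 0 < R4 := hR2p.trans_le (le_max_left _ _)
  have hb4 : ∀ z, R4 ≤ ‖z‖ → ‖deriv W z / W z‖ * ‖z‖ ≤ |A| := by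
    intro z hz
    obtain ⟨h1, h2⟩ := hR3 ‖z‖ ((le_max_right _ _).trans hz) z rfl
    have h3 := hexact z ((le_max_left _ _).trans hz) h2
    simp only [hy] at h3
    rw [h3, norm_div, div_mul_eq_mul_div, div_le_iff₀ (norm_pos_iff.2 h2)]
    rw [Polynomial.eval_mul, Polynomial.eval_X, norm_mul] at h1
    calc _ = ‖z‖ * ‖p.eval z‖ := mul_comm _ _
      _ ≤ A * ‖q.eval z‖ := h1
      _ ≤ _ := by gcongr; exact le_abs_self A
  obtain ⟨C', k', _, hWb⟩ := growth2 hR4p (abs_nonneg A)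
    (fun z hz => hW2 z ((le_max_left _ _).trans hz)) hb4
  exact rat_of_growth hWm hWb

lemma order_nonneg_of_deriv {h : ℂ → ℂ} {z : ℂ}
    (ho : 0 ≤ meromorphicOrderAt (deriv h) z) : 0 ≤ meromorphicOrderAt h z := by
  by_contra hlt
  push Not at hlt
  have hne : meromorphicOrderAt h z ≠ ⊤ := ne_top_of_lt hlt
  lift meromorphicOrderAt h z to ℤ using hne with n hn
  have hn0 : n < 0 := by exact_mod_cast hlt
  rw [meromorphicOrderAt_deriv_eq_sub_one (Int.cast_ne_zero.2 hn0.ne) hn.symm] at ho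
  have : (0:ℤ) ≤ n - 1 := by exact_mod_cast ho
  omega

lemma const_of_deriv {h : ℂ → ℂ} (hh : ∀ z, MeromorphicAt h z)
    (hd : MeroEq (deriv h) (fun _ => 0)) : ∃ c : ℂ, MeroEq h (fun _ => c) := by
  have ho : ∀ z, 0 ≤ meromorphicOrderAt h z := fun z => by
    refine order_nonneg_of_deriv ?_
    rw [meromorphicOrderAt_eq_top_iff.2 (hd z)]; exact le_top
  obtain ⟨H, hH, hHd⟩ := exists_entire hh ho
  have h1 : MeroEq (deriv H) (fun _ => 0) := hH.symm'.deriv'.trans' hd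
  have h2 : ∀ z, deriv H z = 0 := fun z =>
    tendsto_nhds_unique_of_eventuallyEq
      (((hHd.analyticAt z).deriv.continuousAt.tendsto).mono_left nhdsWithin_le_nhds)
      tendsto_const_nhds (h1 z)
  refine ⟨H 0, fun z => (hH z).mono fun w hw => ?_⟩
  rw [hw]; exact is_const_of_deriv_eq_zero hHd h2 w 0

lemma poly_ne_nhdsNE {q : Polynomial ℂ} (hq0 : q ≠ 0) (z : ℂ) : ∀ᶠ w in 𝓝[≠] z, q.eval w ≠ 0 := by
  have : ({w : ℂ | q.IsRoot w} \ {z}).Finite :=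
    (Polynomial.finite_setOfPred_isRoot hq0).subset Set.sdiff_subset
  have h2 : ∀ᶠ w in 𝓝 z, w ∉ ({w : ℂ | q.IsRoot w} \ {z}) :=
    this.isClosed.isOpen_compl.mem_nhds (by simp)
  filter_upwards [h2.filter_mono nhdsWithin_le_nhds, self_mem_nhdsWithin] with w hw hwz h0
  exact hw ⟨h0, hwz⟩

lemma rat_growth (p : Polynomial ℂ) {q : Polynomial ℂ} (hq : q ≠ 0) :
    ∃ (R A : ℝ) (k : ℕ), 1 ≤ R ∧ 0 ≤ A ∧
      ∀ z, R ≤ ‖z‖ → q.eval z ≠ 0 ∧ ‖p.eval z / q.eval z‖ ≤ A * ‖z‖ ^ k := by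
  have hdeg : p.degree ≤ (q * Polynomial.X ^ p.natDegree).degree := by
    rw [Polynomial.degree_mul, Polynomial.degree_X_pow]
    refine Polynomial.degree_le_natDegree.trans (le_add_of_nonneg_left ?_)
    rw [Polynomial.degree_eq_natDegree hq]
    exact_mod_cast Nat.zero_le _
  obtain ⟨A, hA⟩ := (Polynomial.isBigO_cobounded_of_degree_le hdeg).bound
  have h := hA.and (poly_ne_cobounded hq)
  rw [← comap_norm_atTop, eventually_comap] at h
  obtain ⟨R, hR⟩ := eventually_atTop.1 h
  refine ⟨max R 1, |A|, p.natDegree, le_max_right _ _, abs_nonneg _, fun z hz => ?_⟩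
  obtain ⟨h1, h2⟩ := hR ‖z‖ ((le_max_left _ _).trans hz) z rfl
  refine ⟨h2, ?_⟩
  rw [norm_div, div_le_iff₀ (norm_pos_iff.2 h2)]
  simp only [Polynomial.eval_mul, Polynomial.eval_pow, Polynomial.eval_X, norm_mul, norm_pow] at h1
  calc _ ≤ A * (‖q.eval z‖ * ‖z‖ ^ p.natDegree) := h1
    _ ≤ |A| * (‖q.eval z‖ * ‖z‖ ^ p.natDegree) := by gcongr; exact le_abs_self A
    _ = _ := by ring

lemma IsRatFn.congr' {a b : ℂ → ℂ} (h : MeroEq a b) (hb : IsRatFn b) : IsRatFn a := by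
  obtain ⟨p, q, hq, hpq⟩ := hb
  exact ⟨p, q, hq, h.trans' hpq⟩

lemma rat_of_deriv {h : ℂ → ℂ} (hh : ∀ z, MeromorphicAt h z) (hr : IsRatFn (deriv h)) :
    IsRatFn h := by
  obtain ⟨p, q, hq, hpq⟩ := hr
  obtain ⟨R, A, k, hR1, hA, hb⟩ := rat_growth p hq
  obtain ⟨H, hH, hnf⟩ := exists_nf hh
  have hpqc : ∀ z, R ≤ ‖z‖ → AnalyticAt ℂ (fun z => p.eval z / q.eval z) z := fun z hz =>
    ((Polynomial.differentiable p).analyticAt z).div ((Polynomial.differentiable q).analyticAt z)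
      (hb z hz).1
  have hHan : ∀ z, R ≤ ‖z‖ → AnalyticAt ℂ H z := by
    intro z hz
    refine (hnf z).meromorphicOrderAt_nonneg_iff_analyticAt.1 ?_
    rw [← meromorphicOrderAt_congr (hH z)]
    refine order_nonneg_of_deriv ?_
    rw [meromorphicOrderAt_congr (hpq z)]
    exact (hpqc z hz).meromorphicOrderAt_nonneg
  have hHd : ∀ z, R ≤ ‖z‖ → deriv H z = p.eval z / q.eval z := fun z hz =>
    tendsto_nhds_unique_of_eventuallyEq
      ((hHan z hz).deriv.continuousAt.tendsto.mono_left nhdsWithin_le_nhds)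
      ((hpqc z hz).continuousAt.tendsto.mono_left nhdsWithin_le_nhds)
      (hH.symm'.deriv'.trans' hpq z)
  have hR0 : 0 < R := by linarith
  obtain ⟨B, hB⟩ := (isCompact_sphere (0:ℂ) R).bddAbove_image (f := fun z => ‖H z‖)
    (fun z hz => (hHan z (by simp at hz; exact hz.ge)).continuousAt.norm.continuousWithinAt)
  have hgrow : ∀ z, R ≤ ‖z‖ → ‖H z‖ ≤ (|B| + A) * ‖z‖ ^ (k + 1) := by
    intro z hz
    obtain ⟨a, s, ha, hs, hza, hes⟩ := ray_point hR0 hz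
    have hz1 : 1 ≤ ‖z‖ := hR1.trans hz
    have hseg : ∀ w ∈ segment ℝ a z, R ≤ ‖w‖ ∧ ‖w‖ ≤ ‖z‖ ∧ ‖z - a‖ ≤ ‖z‖ := by
      intro w hw
      obtain ⟨u, v, hu, hv, huv, rfl⟩ := hw
      have he1 : 1 ≤ Real.exp s := Real.one_le_exp hs
      have e : u • a + v • z = ((u + v * Real.exp s : ℝ) : ℂ) * a := by
        rw [hza]; simp; ring
      have e2 : z - a = ((Real.exp s - 1 : ℝ) : ℂ) * a := by
        rw [hza]; push_cast; ring
      have e3 : ‖z‖ = Real.exp s * R := by rw [hes]; field_simp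
      have hu' : u = 1 - v := by linarith
      rw [e, e2, norm_mul, norm_mul, Complex.norm_real, Complex.norm_real, Real.norm_of_nonneg
        (by positivity), Real.norm_of_nonneg (by linarith), ha, e3]
      refine ⟨?_, ?_, ?_⟩
      · refine le_mul_of_one_le_left hR0.le ?_
        nlinarith
      · gcongr
        nlinarith
      · gcongr; linarith
    have h1 := (convex_segment a z).norm_image_sub_le_of_norm_deriv_le (𝕜 := ℂ) (f := H)
      (C := A * ‖z‖ ^ k)
      (fun w hw => (hHan w (hseg w hw).1).differentiableAt)
      (fun w hw => by
        rw [hHd w (hseg w hw).1]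
        refine (hb w (hseg w hw).1).2.trans ?_
        gcongr
        exact (hseg w hw).2.1)
      (left_mem_segment ℝ a z) (right_mem_segment ℝ a z)
    have h2 : ‖H a‖ ≤ B := hB ⟨a, by simpa using ha, rfl⟩
    have h3 : ‖H z‖ ≤ ‖H z - H a‖ + ‖H a‖ := by
      simpa using norm_add_le (H z - H a) (H a)
    have h4 : A * ‖z‖ ^ k * ‖z - a‖ ≤ A * ‖z‖ ^ k * ‖z‖ := by
      gcongr; exact (hseg a (left_mem_segment ℝ a z)).2.2
    have h5 : |B| * 1 ≤ |B| * ‖z‖ ^ (k + 1) := by gcongr; exact one_le_pow₀ hz1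
    have h6 := le_abs_self B
    calc ‖H z‖ ≤ A * ‖z‖ ^ k * ‖z‖ + |B| * ‖z‖ ^ (k + 1) := by linarith
      _ = _ := by ring
  exact (rat_of_growth (fun z => (hnf z).meromorphicAt) hgrow).congr' hH

lemma mer_iter {f : ℂ → ℂ} (hf : ∀ z, MeromorphicAt f z) (n : ℕ) :
    ∀ z, MeromorphicAt (iteratedDeriv n f) z := by
  induction n with
  | zero => simpa using hf
  | succ n ih => intro z; rw [iteratedDeriv_succ]; exact (ih z).deriv

lemma rat_of_iter {f : ℂ → ℂ} (hf : ∀ z, MeromorphicAt f z) (n : ℕ)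
    (hr : IsRatFn (iteratedDeriv n f)) : IsRatFn f := by
  induction n with
  | zero => simpa using hr
  | succ n ih =>
    rw [iteratedDeriv_succ] at hr
    exact ih (rat_of_deriv (mer_iter hf n) hr)

lemma rat_inv {W : ℂ → ℂ} (hW : IsRatFn W) (b : ℂ) : IsRatFn (fun z => b / (W z - 1)) := by
  obtain ⟨p, q, hq, h⟩ := hW
  by_cases hpq : p - q = 0
  · refine ⟨0, 1, one_ne_zero, fun z => ?_⟩
    filter_upwards [h z, poly_ne_nhdsNE hq z] with w hw hw2
    have : p = q := sub_eq_zero.1 hpq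
    rw [hw, this, div_self hw2]; simp
  · refine ⟨Polynomial.C b * q, p - q, hpq, fun z => ?_⟩
    filter_upwards [h z, poly_ne_nhdsNE hq z, poly_ne_nhdsNE hpq z] with w hw hw2 hw3
    rw [Polynomial.eval_sub] at hw3
    rw [hw]
    simp only [Polynomial.eval_mul, Polynomial.eval_C, Polynomial.eval_sub]
    rw [div_sub_one hw2, div_div_eq_mul_div]

lemma rat_div {a b : ℂ → ℂ} (ha : IsRatFn a) (hb : IsRatFn b) : IsRatFn (fun z => a z / b z) := by
  obtain ⟨p, q, hq, h⟩ := ha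
  obtain ⟨p', q', hq', h'⟩ := hb
  by_cases hp' : p' = 0
  · refine ⟨0, 1, one_ne_zero, fun z => ?_⟩
    filter_upwards [h' z] with w hw
    simp [hw, hp']
  · refine ⟨p * q', q * p', mul_ne_zero hq hp', fun z => ?_⟩
    filter_upwards [h z, h' z] with w hw hw'
    rw [hw, hw', Polynomial.eval_mul, Polynomial.eval_mul, div_div_div_eq]

lemma rat_const {h : ℂ → ℂ} (hh : ∀ z, MeromorphicAt h z) (hr : IsRatFn h)
    (ho : ∀ z, meromorphicOrderAt h z = 0) : ∃ c : ℂ, MeroEq h (fun _ => c) := by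
  obtain ⟨p, q, hq, hpq⟩ := hr
  obtain ⟨R, A, k, hR1, hA, hb⟩ := rat_growth p hq
  obtain ⟨H, hH, hnf⟩ := exists_nf hh
  have hoH : ∀ z, meromorphicOrderAt H z = 0 := fun z => by
    rw [← meromorphicOrderAt_congr (hH z)]; exact ho z
  have hHd : Differentiable ℂ H := fun z =>
    ((hnf z).meromorphicOrderAt_nonneg_iff_analyticAt.1 (hoH z).ge).differentiableAt
  obtain ⟨r, hr⟩ := entire_poly hHd (R := R) (C := A) (k := k) (fun z hz => by
    have : H z = p.eval z / q.eval z := tendsto_nhds_unique_of_eventuallyEq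
      (hHd.continuous.continuousAt.tendsto.mono_left nhdsWithin_le_nhds)
      ((p.continuous.continuousAt.div q.continuous.continuousAt (hb z hz).1).tendsto.mono_left
        nhdsWithin_le_nhds)
      (hH.symm'.trans' hpq z)
    rw [this]; exact (hb z hz).2)
  have hne : ∀ z, H z ≠ 0 := fun z => (hnf z).meromorphicOrderAt_eq_zero_iff.1 (hoH z)
  have hdeg : r.degree = 0 := by
    by_contra hd
    obtain ⟨x, hx⟩ := IsAlgClosed.exists_root r hd
    exact hne x (by rw [hr]; exact hx)
  rw [Polynomial.eq_C_of_degree_eq_zero hdeg] at hr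
  refine ⟨r.coeff 0, fun z => (hH z).mono fun w hw => ?_⟩
  rw [hw, hr]; simp

lemma mtilde_mtilde (f : ℂ → ℂ) : mtilde (mtilde f) = f := by
  funext z; simp [mtilde]

lemma tendsto_conj_NE (z : ℂ) :
    Tendsto (starRingEnd ℂ) (𝓝[≠] z) (𝓝[≠] ((starRingEnd ℂ) z)) := by
  refine tendsto_nhdsWithin_iff.2 ⟨(Complex.continuous_conj.tendsto z).mono_left nhdsWithin_le_nhds, ?_⟩
  filter_upwards [self_mem_nhdsWithin] with w hw h
  exact hw ((starRingEnd ℂ).injective h)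

lemma MeroEq.tilde {a b : ℂ → ℂ} (h : MeroEq a b) : MeroEq (mtilde a) (mtilde b) := fun z => by
  filter_upwards [(tendsto_conj_NE z).eventually (h _)] with w hw
  simp only [mtilde]; rw [hw]

lemma deriv_mtilde (h : ℂ → ℂ) : deriv (mtilde h) = mtilde (deriv h) := by
  have := deriv_conj_conj (𝕜 := ℂ) (f := h)
  exact this

lemma iter_mtilde (h : ℂ → ℂ) (n : ℕ) :
    iteratedDeriv n (mtilde h) = mtilde (iteratedDeriv n h) := by
  induction n with
  | zero => simp
  | succ n ih => rw [iteratedDeriv_succ, ih, deriv_mtilde, iteratedDeriv_succ]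

lemma analytic_mtilde {g : ℂ → ℂ} {z : ℂ} (hg : AnalyticAt ℂ g ((starRingEnd ℂ) z)) :
    AnalyticAt ℂ (mtilde g) z := by
  rw [Complex.analyticAt_iff_eventually_differentiableAt] at hg ⊢
  filter_upwards [(Complex.continuous_conj.tendsto z).eventually hg] with w hw
  have := DifferentiableAt.conj_conj (𝕜 := ℂ) hw
  rw [Complex.conj_conj] at this
  exact this

lemma mtilde_factor {h g : ℂ → ℂ} {z : ℂ} {n : ℤ}
    (hg : ∀ᶠ w in 𝓝[≠] ((starRingEnd ℂ) z), h w = (w - (starRingEnd ℂ) z) ^ n • g w) :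
    ∀ᶠ w in 𝓝[≠] z, mtilde h w = (w - z) ^ n • mtilde g w := by
  filter_upwards [(tendsto_conj_NE z).eventually hg] with w hw
  simp only [mtilde, hw]
  simp

lemma mer_mtilde {h : ℂ → ℂ} {z : ℂ} (hh : MeromorphicAt h ((starRingEnd ℂ) z)) :
    MeromorphicAt (mtilde h) z := by
  rw [MeromorphicAt.iff_eventuallyEq_zpow_smul_analyticAt] at hh ⊢
  obtain ⟨n, g, hg, h1⟩ := hh
  exact ⟨n, mtilde g, analytic_mtilde hg, mtilde_factor h1⟩

lemma order_mtilde {h : ℂ → ℂ} (z : ℂ) (hh : MeromorphicAt h ((starRingEnd ℂ) z)) :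
    meromorphicOrderAt (mtilde h) z = meromorphicOrderAt h ((starRingEnd ℂ) z) := by
  by_cases ht : meromorphicOrderAt h ((starRingEnd ℂ) z) = ⊤
  · rw [ht, meromorphicOrderAt_eq_top_iff]
    rw [meromorphicOrderAt_eq_top_iff] at ht
    filter_upwards [(tendsto_conj_NE z).eventually ht] with w hw
    simp [mtilde, hw]
  · lift meromorphicOrderAt h ((starRingEnd ℂ) z) to ℤ using ht with n hn
    obtain ⟨g, hg, hg0, h1⟩ := (meromorphicOrderAt_eq_int_iff hh).1 hn.symm
    refine (meromorphicOrderAt_eq_int_iff (mer_mtilde hh)).2 ⟨mtilde g, analytic_mtilde hg, ?_, mtilde_factor h1⟩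
    simpa [mtilde] using hg0

lemma rat_mtilde {f : ℂ → ℂ} (hf : IsRatFn f) : IsRatFn (mtilde f) := by
  obtain ⟨p, q, hq, h⟩ := hf
  refine ⟨p.map (starRingEnd ℂ), q.map (starRingEnd ℂ), ?_, h.tilde.trans' ?_⟩
  · rwa [Ne, Polynomial.map_eq_zero]
  · intro z
    refine Eventually.of_forall fun w => ?_
    have e : ∀ p : Polynomial ℂ, (p.map (starRingEnd ℂ)).eval w
        = (starRingEnd ℂ) (p.eval ((starRingEnd ℂ) w)) := by
      intro p
      have := Polynomial.eval_map_apply (p := p) (starRingEnd ℂ) ((starRingEnd ℂ) w)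
      simpa using this
    simp only [mtilde, e, map_div₀]

lemma ord_tilde_eq {F D : ℂ → ℂ} {c : ℂ} (hc : c ≠ 0) (hF : ∀ z, MeromorphicAt F z)
    (hD : ∀ z, MeromorphicAt D z) (hD0 : ∀ z, 0 ≤ meromorphicOrderAt D z)
    (h : MeroEq (mtilde F) (fun z => c * F z + D z)) (z : ℂ)
    (h1 : z.im ≠ 0 → ¬ 0 < meromorphicOrderAt F z)
    (h2 : z.im ≠ 0 → ¬ 0 < meromorphicOrderAt F ((starRingEnd ℂ) z)) :
    meromorphicOrderAt (mtilde F) z = meromorphicOrderAt F z := by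
  by_cases hz : z.im = 0
  · rw [order_mtilde z (hF _), Complex.conj_eq_iff_im.2 hz]
  specialize h1 hz
  specialize h2 hz
  have hcF : meromorphicOrderAt (fun z => c * F z) z = meromorphicOrderAt F z :=
    meromorphicOrderAt_mul_of_ne_zero (g := fun _ => c) analyticAt_const hc
  have hcm : MeromorphicAt (fun z => c * F z) z := (MeromorphicAt.const c z).mul (hF z)
  have e : meromorphicOrderAt (mtilde F) z = meromorphicOrderAt ((fun z => c * F z) + D) z :=
    meromorphicOrderAt_congr (h z)
  rcases lt_or_eq_of_le (not_lt.1 h1) with h3 | h3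
  · rw [e, meromorphicOrderAt_add_eq_left_of_lt (hD z) (by rw [hcF]; exact h3.trans_le (hD0 z)), hcF]
  · rw [h3]
    refine le_antisymm ?_ ?_
    · rw [order_mtilde z (hF _)]; exact not_lt.1 h2
    · rw [e]
      refine le_trans ?_ (meromorphicOrderAt_add hcm (hD z))
      rw [hcF, h3]; exact le_min le_rfl (hD0 z)

lemma deriv3_inv {W : ℂ → ℂ} {z b : ℂ} (hW : AnalyticAt ℂ W z) (h1 : W z - 1 ≠ 0) :
    deriv (deriv (deriv (fun w => b / (W w - 1)))) z = - b * NumW W z / (W z - 1) ^ 4 := by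
  have hev : ∀ᶠ w in 𝓝 z, AnalyticAt ℂ W w ∧ W w - 1 ≠ 0 :=
    hW.eventually_analyticAt.and
      ((hW.continuousAt.sub continuousAt_const).eventually_ne h1)
  have d1 : deriv (fun w => b / (W w - 1)) =ᶠ[𝓝 z] fun w => - b * deriv W w / (W w - 1) ^ 2 := by
    filter_upwards [hev] with w hw
    have := ((hasDerivAt_const w b).div (hw.1.differentiableAt.hasDerivAt.sub_const 1) hw.2).deriv
    refine this.trans ?_
    congr 1; ring
  have d2 : deriv (deriv (fun w => b / (W w - 1))) =ᶠ[𝓝 z]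
      fun w => - b * (deriv (deriv W) w * (W w - 1) - 2 * deriv W w ^ 2) / (W w - 1) ^ 3 := by
    filter_upwards [d1.deriv, hev] with w hw hw2
    rw [hw]
    have hh := ((hw2.1.deriv.differentiableAt.hasDerivAt.const_mul (-b)).div
      ((hw2.1.differentiableAt.hasDerivAt.sub_const 1).pow 2) (pow_ne_zero 2 hw2.2)).deriv
    refine hh.trans ?_
    have := hw2.2
    simp only [Pi.pow_apply]
    field_simp
    ring
  rw [d2.deriv_eq]
  have hh := ((((hW.deriv.deriv.differentiableAt.hasDerivAt.mul
    (hW.differentiableAt.hasDerivAt.sub_const 1)).sub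
    ((hW.deriv.differentiableAt.hasDerivAt.pow 2).const_mul 2)).const_mul (-b)).div
      ((hW.differentiableAt.hasDerivAt.sub_const 1).pow 3) (pow_ne_zero 3 h1)).deriv
  refine hh.trans ?_
  simp only [Pi.pow_apply, Pi.mul_apply, Pi.sub_apply]
  unfold NumW
  field_simp
  ring

lemma F_rational {F : ℂ → ℂ} {c κ : ℂ} (hF : ∀ z, MeromorphicAt F z)
    (hne : ∀ z, meromorphicOrderAt F z ≠ ⊤) (hc : ‖c‖ = 1) (hκ : κ ≠ 0)
    (h : MeroEq (mtilde F) (fun z => c * F z + κ))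
    (hz0 : {z : ℂ | 0 < meromorphicOrderAt F z ∧ z.im ≠ 0}.Finite)
    (hz3 : {z : ℂ | 0 < meromorphicOrderAt (deriv (deriv (deriv F))) z ∧ z.im ≠ 0}.Finite) :
    IsRatFn F := by
  have hc0 : c ≠ 0 := fun h => by simp [h] at hc
  obtain ⟨R0, hR0⟩ := (hz0.union hz3).isBounded.exists_norm_le
  have hFne : ∀ z, ∀ᶠ w in 𝓝[≠] z, F w ≠ 0 := fun z =>
    (meromorphicOrderAt_ne_top_iff_eventually_ne_zero (hF z)).1 (hne z)
  have htm : ∀ z, MeromorphicAt (mtilde F) z := fun z => mer_mtilde (hF _)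
  have hcm : ∀ z, MeromorphicAt (fun z => c * F z) z := fun z =>
    (MeromorphicAt.const c z).mul (hF z)
  have hcF : ∀ z, meromorphicOrderAt (fun z => c * F z) z = meromorphicOrderAt F z := fun z =>
    meromorphicOrderAt_mul_of_ne_zero (g := fun _ => c) analyticAt_const hc0
  have hVm : ∀ z, MeromorphicAt (fun z => mtilde F z / (c * F z)) z := fun z =>
    (htm z).div (hcm z)
  have hVo : ∀ z, R0 < ‖z‖ → meromorphicOrderAt (fun z => mtilde F z / (c * F z)) z = 0 := by
    intro z hz
    have e1 : meromorphicOrderAt (fun z => mtilde F z / (c * F z)) z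
        = meromorphicOrderAt (mtilde F) z - meromorphicOrderAt (fun z => c * F z) z :=
      meromorphicOrderAt_div (htm z) (hcm z)
    have e2 := ord_tilde_eq hc0 hF (D := fun _ => κ) (fun z => MeromorphicAt.const κ z)
      (fun z => analyticAt_const.meromorphicOrderAt_nonneg) h z
      (fun him hp => absurd (hR0 z (Or.inl ⟨hp, him⟩)) (not_le.2 hz))
      (fun him hp => absurd (hR0 _ (Or.inl ⟨hp, by simpa using him⟩)) (not_le.2 (by simpa using hz)))
    rw [e1, e2, hcF]
    have := hne z
    lift meromorphicOrderAt F z to ℤ using this with n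
    norm_cast
    simp
  obtain ⟨W, hVW, hnf⟩ := exists_nf hVm
  have hWo : ∀ z, R0 < ‖z‖ → meromorphicOrderAt W z = 0 := fun z hz => by
    rw [← meromorphicOrderAt_congr (hVW z)]; exact hVo z hz
  have hWan : ∀ z, R0 < ‖z‖ → AnalyticAt ℂ W z ∧ W z ≠ 0 := fun z hz =>
    ⟨(hnf z).meromorphicOrderAt_nonneg_iff_analyticAt.1 (hWo z hz).ge,
      (hnf z).meromorphicOrderAt_eq_zero_iff.1 (hWo z hz)⟩
  have hWF : MeroEq F (fun z => (κ / c) / (W z - 1)) := fun z => by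
    filter_upwards [hVW z, hFne z, h z] with w h1 h2 h3
    rw [← h1, h3]
    have : (c * F w + κ) / (c * F w) - 1 = κ / (c * F w) := by field_simp; ring
    rw [this]; field_simp
  have hreal : ∀ x : ℝ, R0 < |x| → ‖W x‖ = 1 := by
    intro x hx
    have hWx := (hWan x (by simpa using hx)).1.continuousAt
    have ht : Tendsto (fun t : ℝ => (t : ℂ)) (𝓝[≠] x) (𝓝[≠] (x : ℂ)) := by
      refine tendsto_nhdsWithin_iff.2
        ⟨(Complex.continuous_ofReal.tendsto x).mono_left nhdsWithin_le_nhds, ?_⟩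
      filter_upwards [self_mem_nhdsWithin] with w hw h
      exact hw (Complex.ofReal_injective h)
    refine tendsto_nhds_unique_of_eventuallyEq
      ((hWx.norm.tendsto.mono_left nhdsWithin_le_nhds).comp ht) tendsto_const_nhds ?_
    filter_upwards [ht.eventually (hVW x), ht.eventually (hFne x)] with t h1 h2
    simp only [Function.comp]
    rw [← h1]
    simp only [mtilde, Complex.conj_ofReal, norm_div, norm_mul, hc, one_mul, RCLike.norm_conj]
    exact div_self (norm_ne_zero_iff.2 h2)
  have hWr : IsRatFn W := by
    refine W_rational (fun z => (hnf z).meromorphicAt) hWan ?_ hreal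
    intro z hz hlt hN
    have him : z.im ≠ 0 := by
      intro h0
      have hzz : ((z.re : ℝ) : ℂ) = z := Complex.ext (by simp) (by simp [h0])
      have := hreal z.re (by rw [← hzz] at hz; simpa using hz)
      rw [hzz] at this
      linarith
    have hW1 : W z - 1 ≠ 0 := by
      intro h0
      rw [sub_eq_zero.1 h0] at hlt; simp at hlt
    have hG : AnalyticAt ℂ (fun w => (κ / c) / (W w - 1)) z :=
      analyticAt_const.div ((hWan z hz).1.sub analyticAt_const) hW1
    have h3 := hG.deriv.deriv.deriv
    have h4 : Tendsto (deriv (deriv (deriv F))) (𝓝[≠] z) (𝓝 0) := by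
      have h5 := h3.continuousAt.tendsto.mono_left (nhdsWithin_le_nhds (s := {z}ᶜ))
      rw [deriv3_inv (hWan z hz).1 hW1, hN, mul_zero, zero_div] at h5
      exact h5.congr' (hWF.deriv'.deriv'.deriv'.symm' z)
    have h6 := (tendsto_zero_iff_meromorphicOrderAt_pos (hF z).deriv.deriv.deriv).1 h4
    exact absurd (hR0 z (Or.inr ⟨h6, him⟩)) (not_le.2 hz)
  exact (rat_inv hWr (κ / c)).congr' hWF

lemma im_ne_infinite : {z : ℂ | z.im ≠ 0}.Infinite := by
  refine Set.infinite_of_injective_forall_mem (f := fun n : ℕ => (((n : ℝ) + 1 : ℝ) : ℂ) * Complex.I) ?_ ?_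
  · intro a b hab
    have := congrArg Complex.im hab
    simpa using this
  · intro n
    have : (n : ℝ) + 1 ≠ 0 := by positivity
    simpa using this

lemma order_ne_top_of_fin {h : ℂ → ℂ} (hh : ∀ z, MeromorphicAt h z)
    (hf : {z : ℂ | 0 < meromorphicOrderAt h z ∧ z.im ≠ 0}.Finite) (z : ℂ) :
    meromorphicOrderAt h z ≠ ⊤ := by
  intro ht
  apply im_ne_infinite
  refine hf.subset fun w hw => ⟨?_, hw⟩
  have : meromorphicOrderAt h w = ⊤ := by
    by_contra hne
    exact MeromorphicOn.meromorphicOrderAt_ne_top_of_isPreconnected (U := Set.univ)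
      (fun z _ => hh z) isPreconnected_univ (Set.mem_univ w) (Set.mem_univ z) hne ht
  rw [this]; exact WithTop.top_pos

lemma case_iii {φ : ℂ → ℂ} (hφ : ∀ z, MeromorphicAt φ z)
    (hne : ∀ z, meromorphicOrderAt φ z ≠ ⊤)
    (h : MeroEq (fun z => deriv (mtilde φ) z / mtilde φ z) (fun z => deriv φ z / φ z)) :
    ∃ c : ℂ, MeroEq (mtilde φ) (fun z => c * φ z) := by
  have htm : ∀ z, MeromorphicAt (mtilde φ) z := fun z => mer_mtilde (hφ _)
  have h1 : ∀ z, ∀ᶠ w in 𝓝[≠] z, φ w ≠ 0 := fun z =>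
    (meromorphicOrderAt_ne_top_iff_eventually_ne_zero (hφ z)).1 (hne z)
  have h2 : ∀ z, ∀ᶠ w in 𝓝[≠] z, mtilde φ w ≠ 0 := fun z =>
    (meromorphicOrderAt_ne_top_iff_eventually_ne_zero (htm z)).1
      (by rw [order_mtilde z (hφ _)]; exact hne _)
  obtain ⟨c, hc⟩ := const_of_deriv (h := fun z => mtilde φ z / φ z)
    (fun z => (htm z).div (hφ z)) (fun z => by
      filter_upwards [h z, h1 z, h2 z, (hφ z).eventually_analyticAt, (htm z).eventually_analyticAt]
        with w hw hw1 hw2 hw3 hw4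
      refine (hw4.differentiableAt.hasDerivAt.div hw3.differentiableAt.hasDerivAt hw1).deriv.trans ?_
      rw [div_eq_div_iff hw2 hw1] at hw
      rw [hw]
      simp [mul_comm])
  refine ⟨c, fun z => ?_⟩
  filter_upwards [hc z, h1 z] with w hw hw1
  rw [← hw]; field_simp

lemma norm_c {φ : ℂ → ℂ} (hφ : ∀ z, MeromorphicAt φ z)
    (hne : ∀ z, meromorphicOrderAt φ z ≠ ⊤) {c : ℂ}
    (h : MeroEq (mtilde φ) (fun z => c * φ z)) : ‖c‖ = 1 := by
  have h1 := h.tilde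
  rw [mtilde_mtilde] at h1
  obtain ⟨w, hw1, hw2, hw3⟩ := ((h1 0).and ((h 0).and
    ((meromorphicOrderAt_ne_top_iff_eventually_ne_zero (hφ 0)).1 (hne 0)))).exists
  have e : mtilde (fun z => c * φ z) w = (starRingEnd ℂ) c * mtilde φ w := by simp [mtilde]
  rw [e, hw2] at hw1
  have h3 : ‖φ w‖ = ‖c‖ * (‖c‖ * ‖φ w‖) := by
    conv_lhs => rw [hw1]
    simp
  have h4 : 0 < ‖φ w‖ := norm_pos_iff.2 hw3
  have h5 : ‖c‖ * ‖c‖ = 1 := by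
    have : (‖c‖ * ‖c‖ - 1) * ‖φ w‖ = 0 := by linarith
    rcases mul_eq_zero.1 this with h | h <;> linarith
  nlinarith [norm_nonneg c]

theorem main_thm (M : ℕ) (f : ℂ → ℂ) (hs : Setup M f) (m : ℕ) (hm : m ≤ M + 1)
    (hcase :
      MeroEq (mtilde (fun z => iteratedDeriv (m + 1) f z / iteratedDeriv m f z))
        (fun z => iteratedDeriv (m + 1) f z / iteratedDeriv m f z) ∨
      MeroEq (Fm f m) (Fm (mtilde f) m) ∨
      ∃ c : ℂ, MeroEq (iteratedDeriv m (mtilde f)) (fun z => c * iteratedDeriv m f z)) :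
    IsRatFn f ∧ ∃ z : ℂ, 0 < meroOrder f z ∧ z.im ≠ 0 := by
  obtain ⟨hM, hf, hsnr, hfin⟩ := hs
  have hmi := mer_iter hf
  have hmo : ∀ {h : ℂ → ℂ}, (∀ z, MeromorphicAt h z) → ∀ z, meroOrder h z = meromorphicOrderAt h z :=
    fun hh z => dif_pos (hh z)
  simp only [hmo (hmi _)] at hfin
  have hnt : ∀ j, j ≤ M + 3 → ∀ z, meromorphicOrderAt (iteratedDeriv j f) z ≠ ⊤ :=
    fun j hj => order_ne_top_of_fin (hmi j) (hfin j hj)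
  have hc : ∃ c : ℂ, MeroEq (mtilde (iteratedDeriv m f)) (fun z => c * iteratedDeriv m f z) := by
    rcases hcase with h | h | h
    · refine case_iii (hmi m) (hnt m (by omega)) ?_
      rw [deriv_mtilde, ← iteratedDeriv_succ]
      intro z
      filter_upwards [h z] with w hw
      rw [← hw]; simp [mtilde]
    · refine case_iii (hmi m) (hnt m (by omega)) ?_
      rw [deriv_mtilde, ← iteratedDeriv_succ]
      intro z
      filter_upwards [h z] with w hw
      simp only [Fm, iter_mtilde] at hw
      have := sub_right_injective hw
      rw [← inv_div, ← inv_div (iteratedDeriv m f w)]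
      exact congrArg _ this.symm
    · rwa [iter_mtilde] at h
  obtain ⟨c, hc⟩ := hc
  have hc1 := norm_c (hmi m) (hnt m (by omega)) hc
  have hc0 : c ≠ 0 := fun h => by simp [h] at hc1
  set D : ℕ → ℂ → ℂ := fun j z => mtilde (iteratedDeriv j f) z - c * iteratedDeriv j f z with hD
  have htm : ∀ j z, MeromorphicAt (mtilde (iteratedDeriv j f)) z := fun j z => mer_mtilde (hmi j _)
  have hDm : ∀ j z, MeromorphicAt (D j) z := fun j z =>
    (htm j z).sub ((MeromorphicAt.const c z).mul (hmi j z))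
  have hDd : ∀ j, MeroEq (deriv (D j)) (D (j + 1)) := fun j z => by
    filter_upwards [(hmi j z).eventually_analyticAt, (htm j z).eventually_analyticAt] with w h1 h2
    refine (h2.differentiableAt.hasDerivAt.sub
      (h1.differentiableAt.hasDerivAt.const_mul c)).deriv.trans ?_
    simp only [hD]
    rw [iteratedDeriv_succ, deriv_mtilde]
  have hDm0 : MeroEq (D m) (fun _ => 0) := fun z => (hc z).mono fun w hw => by
    simp only [hD]; rw [hw]; simp
  have hD00 : ¬ MeroEq (D 0) (fun _ => 0) := fun h0 => hsnr ⟨c, fun z => by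
    filter_upwards [h0 z] with w hw
    have := sub_eq_zero.1 hw
    simpa using this⟩
  have hex : ∃ j, MeroEq (D j) (fun _ => 0) := ⟨m, hDm0⟩
  set k := Nat.find hex with hk
  have hk0 : k ≠ 0 := fun h => hD00 (by have := Nat.find_spec hex; rwa [← hk, h] at this)
  have hkm : k ≤ m := Nat.find_min' hex hDm0
  obtain ⟨d, hd⟩ := Nat.exists_eq_succ_of_ne_zero hk0
  have hDk : MeroEq (D (d + 1)) (fun _ => 0) := by
    have := Nat.find_spec hex; rwa [← hk, hd] at this
  have hDd0 : ¬ MeroEq (D d) (fun _ => 0) := Nat.find_min hex (by omega)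
  obtain ⟨κ, hκ⟩ := const_of_deriv (hDm d) ((hDd d).trans' hDk)
  have hκ0 : κ ≠ 0 := fun h => hDd0 (by rw [h] at hκ; exact hκ)
  have hrat : IsRatFn f := by
    refine rat_of_iter hf d (F_rational (hmi d) (hnt d (by omega)) hc1 hκ0 (fun z => ?_)
      (hfin d (by omega)) ?_)
    · filter_upwards [hκ z] with w hw
      rw [← hw]; simp [hD]
    · have := hfin (d + 3) (by omega)
      simpa only [iteratedDeriv_succ] using this
  refine ⟨hrat, ?_⟩
  have hD0 : ∀ z, 0 ≤ meromorphicOrderAt (D 0) z := by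
    intro z
    have : ∀ j, j ≤ d + 1 → 0 ≤ meromorphicOrderAt (D (d + 1 - j)) z := by
      intro j
      induction j with
      | zero =>
        intro _
        rw [Nat.sub_zero, meromorphicOrderAt_eq_top_iff.2 (hDk z)]; exact le_top
      | succ j ih =>
        intro hj
        refine order_nonneg_of_deriv ?_
        rw [meromorphicOrderAt_congr (hDd _ z)]
        have e : d + 1 - (j + 1) + 1 = d + 1 - j := by omega
        rw [e]; exact ih (by omega)
    simpa using this (d + 1) le_rfl
  by_contra hno
  push Not at hno
  simp only [hmo hf] at hno
  have hff : MeroEq (mtilde f) (fun z => c * f z + D 0 z) := fun z =>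
    Eventually.of_forall fun w => by simp [hD]
  have hord : ∀ z, meromorphicOrderAt (mtilde f) z = meromorphicOrderAt f z := fun z =>
    ord_tilde_eq hc0 hf (hDm 0) hD0 hff z (fun him hp => him (hno z hp))
      (fun him hp => him (by simpa using hno _ hp))
  have hfnt : ∀ z, meromorphicOrderAt f z ≠ ⊤ := by simpa using hnt 0 (by omega)
  have htf : ∀ z, MeromorphicAt (mtilde f) z := fun z => mer_mtilde (hf _)
  obtain ⟨c', hc'⟩ := rat_const (h := fun z => mtilde f z / f z) (fun z => (htf z).div (hf z))
    (rat_div (rat_mtilde hrat) hrat) (fun z => by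
      have e1 : meromorphicOrderAt (fun z => mtilde f z / f z) z
          = meromorphicOrderAt (mtilde f) z - meromorphicOrderAt f z :=
        meromorphicOrderAt_div (htf z) (hf z)
      rw [e1, hord]
      have := hfnt z
      lift meromorphicOrderAt f z to ℤ using this with n
      norm_cast
      simp)
  refine hsnr ⟨c', fun z => ?_⟩
  filter_upwards [hc' z, (meromorphicOrderAt_ne_top_iff_eventually_ne_zero (hf z)).1 (hfnt z)]
    with w h1 h2
  rw [← h1]; field_simp

/-- Lemma 3.3 of the paper: under the Setup, if `f^(m+1)/f^(m)` is real
meromorphic, or `F_m = G_m`, or `g^(m) = c_m f^(m)` for some constant `c_m`, then `f` is a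
rational function with at least one non-real zero. -/
theorem statement_11 (M : ℕ) (f : ℂ → ℂ) (hs : Setup M f) (m : ℕ) (hm : m ≤ M + 1)
    (hcase :
      MeroEq (mtilde (fun z => iteratedDeriv (m + 1) f z / iteratedDeriv m f z))
        (fun z => iteratedDeriv (m + 1) f z / iteratedDeriv m f z) ∨
      MeroEq (Fm f m) (Fm (mtilde f) m) ∨
      ∃ c : ℂ, MeroEq (iteratedDeriv m (mtilde f)) (fun z => c * iteratedDeriv m f z)) :
    IsRatFn f ∧ ∃ z : ℂ, 0 < meroOrder f z ∧ z.im ≠ 0 := by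
  exact main_thm M f hs m hm hcase
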